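/- arXiv:1911.04743 — 3 statements merged into one kernel-verified Lean document; each statement's English description precedes it below -/
import Mathlib

section
/- Define Φ_MAX(G) to be the n-tuple consisting of the MAX-costs c^MAX_u(G) of all n players sorted in non-increasing order, and compare such tuples by the lexicographic order >_lex. Let k ≥ 1 and let G be a tree on n vertices. If a player u is unhappy in G with respect to the MAX-cost (pessimistic, k-local information) via an edge swap (v, w) and performs this swap, yielding the tree G', then Φ_MAX(G) >_lex Φ_MAX(G'). Consequently, every sequence of such edge swaps starting from an n-vertex tree is finite and ends in a max-swap equilibrium (the MAX swap game starting from a tree has the finite improvement property), and there is an absolute constant C > 0 such that every such sequence has length at most C·n³. -/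
open SimpleGraph

namespace SwapGame

/-- The set of vertices within distance `k` of `u` in `G` (the `k`-neighborhood). -/
def ball {V : Type} (G : SimpleGraph V) (u : V) (k : ℕ) : Set V :=
  {v | G.edist u v ≤ (k : ℕ∞)}

/-- The graph obtained from `G` by the edge swap `(v, w)` at `u`:
remove the edge `{u, v}` and add the edge `{u, w}`. -/
def swapGraph {V : Type} (G : SimpleGraph V) (u v w : V) : SimpleGraph V :=
  SimpleGraph.fromEdgeSet ((G.edgeSet \ {s(u, v)}) ∪ {s(u, w)})

/-- The edge swap `(v, w)` at `u` is a legal move for a player with `k`-local information: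
`v` is a neighbor of `u` and `w` is a non-neighbor (other than `u`) within distance `k`. -/
def ValidSwap {V : Type} (G : SimpleGraph V) (k : ℕ) (u v w : V) : Prop :=
  G.Adj u v ∧ G.edist u w ≤ (k : ℕ∞) ∧ ¬ G.Adj u w ∧ w ≠ u

/-- `H` (a graph on `W`, with `ι` identifying the view inside `H`) is a finite connected
graph compatible with `u`'s `k`-local view in `G`. -/
def Compatible {V : Type} (G : SimpleGraph V) (k : ℕ) (u : V)
    {W : Type} (H : SimpleGraph W) (ι : V → W) : Prop :=
  Finite W ∧ H.Connected ∧ Set.InjOn ι (ball G u k) ∧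
  {x : W | H.edist (ι u) x ≤ (k : ℕ∞)} = ι '' ball G u k ∧
  ∀ a ∈ ball G u k, ∀ b ∈ ball G u k, (H.Adj (ι a) (ι b) ↔ G.Adj a b)

/-- SUM-cost of player `u` in `H` (`⊤` when `H` is disconnected). -/
noncomputable def cSum {W : Type} (H : SimpleGraph W) (u : W) : ℕ∞ :=
  ∑' v, H.edist u v

/-- MAX-cost (eccentricity) of player `u` in `H` (`⊤` when `H` is disconnected). -/
noncomputable def cMax {W : Type} (H : SimpleGraph W) (u : W) : ℕ∞ :=
  ⨆ v, H.edist u v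

/-- A pessimistic player `u` with `k`-local information is unhappy in `G` w.r.t. the
SUM-cost via the edge swap `(v, w)`: the swap strictly decreases `u`'s cost in every
compatible global graph. -/
def UnhappySumVia {V : Type} (G : SimpleGraph V) (k : ℕ) (u v w : V) : Prop :=
  ValidSwap G k u v w ∧
  ∀ (W : Type) (H : SimpleGraph W) (ι : V → W), Compatible G k u H ι →
    cSum (swapGraph H (ι u) (ι v) (ι w)) (ι u) < cSum H (ι u)

/-- Pessimistic unhappiness w.r.t. the MAX-cost via the edge swap `(v, w)`. -/
def UnhappyMaxVia {V : Type} (G : SimpleGraph V) (k : ℕ) (u v w : V) : Prop :=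
  ValidSwap G k u v w ∧
  ∀ (W : Type) (H : SimpleGraph W) (ι : V → W), Compatible G k u H ι →
    cMax (swapGraph H (ι u) (ι v) (ι w)) (ι u) < cMax H (ι u)

/-- Weakly pessimistic unhappiness w.r.t. the SUM-cost via the edge swap `(v, w)`:
the swap does not increase `u`'s cost in any compatible global graph. -/
def WeakUnhappySumVia {V : Type} (G : SimpleGraph V) (k : ℕ) (u v w : V) : Prop :=
  ValidSwap G k u v w ∧
  ∀ (W : Type) (H : SimpleGraph W) (ι : V → W), Compatible G k u H ι →
    cSum (swapGraph H (ι u) (ι v) (ι w)) (ι u) ≤ cSum H (ι u)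

/-- Weakly pessimistic unhappiness w.r.t. the MAX-cost via the edge swap `(v, w)`. -/
def WeakUnhappyMaxVia {V : Type} (G : SimpleGraph V) (k : ℕ) (u v w : V) : Prop :=
  ValidSwap G k u v w ∧
  ∀ (W : Type) (H : SimpleGraph W) (ι : V → W), Compatible G k u H ι →
    cMax (swapGraph H (ι u) (ι v) (ι w)) (ι u) ≤ cMax H (ι u)

/-- Optimistic unhappiness w.r.t. the SUM-cost via the edge swap `(v, w)`:
the swap strictly decreases `u`'s cost in some compatible global graph
(with the swapped graph connected). -/
def OptUnhappySumVia {V : Type} (G : SimpleGraph V) (k : ℕ) (u v w : V) : Prop :=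
  ValidSwap G k u v w ∧
  ∃ (W : Type) (H : SimpleGraph W) (ι : V → W), Compatible G k u H ι ∧
    (swapGraph H (ι u) (ι v) (ι w)).Connected ∧
    cSum (swapGraph H (ι u) (ι v) (ι w)) (ι u) < cSum H (ι u)

/-- Optimistic unhappiness w.r.t. the MAX-cost via the edge swap `(v, w)`. -/
def OptUnhappyMaxVia {V : Type} (G : SimpleGraph V) (k : ℕ) (u v w : V) : Prop :=
  ValidSwap G k u v w ∧
  ∃ (W : Type) (H : SimpleGraph W) (ι : V → W), Compatible G k u H ι ∧
    (swapGraph H (ι u) (ι v) (ι w)).Connected ∧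
    cMax (swapGraph H (ι u) (ι v) (ι w)) (ι u) < cMax H (ι u)

/-- Sum-swap equilibrium for pessimistic players with `k`-local information. -/
def SumEquilibrium {V : Type} (G : SimpleGraph V) (k : ℕ) : Prop :=
  ∀ u : V, ¬ ∃ v w, UnhappySumVia G k u v w

/-- Max-swap equilibrium for pessimistic players with `k`-local information. -/
def MaxEquilibrium {V : Type} (G : SimpleGraph V) (k : ℕ) : Prop :=
  ∀ u : V, ¬ ∃ v w, UnhappyMaxVia G k u v w

/-- Sum-swap equilibrium for weakly pessimistic players with `k`-local information. -/
def WeakSumEquilibrium {V : Type} (G : SimpleGraph V) (k : ℕ) : Prop :=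
  ∀ u : V, ¬ ∃ v w, WeakUnhappySumVia G k u v w

/-- Max-swap equilibrium for weakly pessimistic players with `k`-local information. -/
def WeakMaxEquilibrium {V : Type} (G : SimpleGraph V) (k : ℕ) : Prop :=
  ∀ u : V, ¬ ∃ v w, WeakUnhappyMaxVia G k u v w

/-- Sum-swap equilibrium for optimistic players with `k`-local information. -/
def OptSumEquilibrium {V : Type} (G : SimpleGraph V) (k : ℕ) : Prop :=
  ∀ u : V, ¬ ∃ v w, OptUnhappySumVia G k u v w

/-- Max-swap equilibrium for optimistic players with `k`-local information. -/
def OptMaxEquilibrium {V : Type} (G : SimpleGraph V) (k : ℕ) : Prop :=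
  ∀ u : V, ¬ ∃ v w, OptUnhappyMaxVia G k u v w

/-- Social SUM-cost of a (connected, finite) graph, as a natural number. -/
noncomputable def scSum {W : Type} [Fintype W] (H : SimpleGraph W) : ℕ :=
  ∑ u : W, ∑ v : W, H.dist u v

/-- Social MAX-cost of a (connected, finite) graph, as a natural number. -/
noncomputable def scMax {W : Type} [Fintype W] (H : SimpleGraph W) : ℕ :=
  ∑ u : W, Finset.univ.sup (H.dist u)

/-- Price of anarchy over `n`-vertex trees for a given notion of equilibrium and
social cost: (max social cost of an equilibrium tree) / (min social cost of a tree). -/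
noncomputable def PoA (n : ℕ) (eqPred : SimpleGraph (Fin n) → Prop)
    (sc : SimpleGraph (Fin n) → ℕ) : ℚ :=
  ((sSup {m : ℕ | ∃ T : SimpleGraph (Fin n), T.IsTree ∧ eqPred T ∧ sc T = m} : ℕ) : ℚ) /
  ((sInf {m : ℕ | ∃ T : SimpleGraph (Fin n), T.IsTree ∧ sc T = m} : ℕ) : ℚ)

/-- The `n`-tuple of all players' MAX-costs, sorted in non-increasing order. -/
noncomputable def phiMax {W : Type} [Fintype W] (H : SimpleGraph W) : List ℕ∞ :=
  ((Finset.univ.val.map (fun u : W => cMax H u)).sort (· ≤ ·)).reverse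

/-! ### Distances in trees -/

section Tree

variable {V : Type} {G : SimpleGraph V}

lemma dist_eq_add_of_mem_support (hG : G.Connected) {x y z : V} {p : G.Walk x y}
    (hp : p.length = G.dist x y) (hz : z ∈ p.support) :
    G.dist x y = G.dist x z + G.dist z y := by
  classical
  have hlen : (p.takeUntil z hz).length + (p.dropUntil z hz).length = p.length := by
    rw [← Walk.length_append, Walk.take_spec]
  have h1 := dist_le (p.takeUntil z hz)
  have h2 := dist_le (p.dropUntil z hz)
  have h3 := hG.dist_triangle (u := x) (v := z) (w := y)
  omega

/-- Distances in a forest agree with those in a subgraph, as long as the latter are finite. -/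
lemma dist_eq_of_le_of_reachable {K : SimpleGraph V} (hG : G.IsAcyclic) (hle : K ≤ G) {x y : V}
    (h : K.Reachable x y) : G.dist x y = K.dist x y := by
  obtain ⟨p, hp, hpl⟩ := h.exists_path_of_dist
  obtain ⟨q, hq, hql⟩ := (h.mono hle).exists_path_of_dist
  have hpq := (hG.subsingleton_path x y).elim ⟨p.mapLe hle, (Walk.isPath_mapLe hle).2 hp⟩ ⟨q, hq⟩
  have hpq' : p.mapLe hle = q := congrArg Subtype.val hpq
  rw [← hql, ← hpq', Walk.length_mapLe, hpl]

lemma not_reachable_deleteEdges (hG : G.IsTree) {u v : V} (huv : G.Adj u v) :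
    ¬ (G.deleteEdges {s(u, v)}).Reachable u v :=
  isBridge_iff.1 (isAcyclic_iff_forall_isBridge.1 hG.isAcyclic ((mem_edgeSet G).2 huv))

lemma reachable_deleteEdges_of_dist_le (hG : G.Connected) {u v x : V} (huv : G.Adj u v)
    (h : G.dist x u ≤ G.dist x v) : (G.deleteEdges {s(u, v)}).Reachable u x := by
  obtain ⟨p, hp⟩ := hG.exists_walk_length_eq_dist x u
  refine (reachable_deleteEdges_iff_exists_walk.2 ⟨p, fun hmem => ?_⟩).symm
  have h1 := dist_eq_add_of_mem_support hG hp (p.snd_mem_support_of_mem_edges hmem)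
  have h2 := dist_eq_one_iff_adj.2 huv.symm
  omega

lemma reachable_deleteEdges_or (hG : G.Connected) {u v : V} (huv : G.Adj u v) (x : V) :
    (G.deleteEdges {s(u, v)}).Reachable u x ∨ (G.deleteEdges {s(u, v)}).Reachable v x := by
  rcases le_total (G.dist x u) (G.dist x v) with h | h
  · exact .inl (reachable_deleteEdges_of_dist_le hG huv h)
  · right
    rw [Sym2.eq_swap]
    exact reachable_deleteEdges_of_dist_le hG huv.symm h

/-- In a tree, the distance between vertices on different sides of an edge is realised through
that edge. -/
lemma dist_eq_of_reachable_deleteEdges (hG : G.IsTree) {u v : V} (huv : G.Adj u v) {x y : V}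
    (hx : (G.deleteEdges {s(u, v)}).Reachable u x)
    (hy : (G.deleteEdges {s(u, v)}).Reachable v y) :
    G.dist x y = G.dist x u + 1 + G.dist v y := by
  have hcross : ∀ z, (G.deleteEdges {s(u, v)}).Reachable u z →
      ∀ p : G.Walk z y, s(u, v) ∈ p.edges := fun z hz p => by
    by_contra hmem
    exact not_reachable_deleteEdges hG huv
      ((hz.trans (reachable_deleteEdges_iff_exists_walk.2 ⟨p, hmem⟩)).trans hy.symm)
  obtain ⟨p, hp⟩ := hG.connected.exists_walk_length_eq_dist x y
  obtain ⟨q, hq⟩ := hG.connected.exists_walk_length_eq_dist u y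
  have h1 := dist_eq_add_of_mem_support hG.connected hp
    (p.fst_mem_support_of_mem_edges (hcross x hx p))
  have h2 := dist_eq_add_of_mem_support hG.connected hq
    (q.snd_mem_support_of_mem_edges (hcross u .rfl q))
  have h3 := dist_eq_one_iff_adj.2 huv
  omega

/-- The four-point condition for trees. -/
lemma four_point (hG : G.IsTree) (p q x b : V) :
    G.dist b x + G.dist p q ≤ max (G.dist b p + G.dist x q) (G.dist b q + G.dist x p) := by
  generalize hm : G.dist b x = m
  induction m generalizing b with
  | zero =>
    obtain rfl := hG.connected.dist_eq_zero_iff.1 hm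
    have := hG.connected.dist_triangle (u := p) (v := b) (w := q)
    rw [dist_comm (u := p) (v := b)] at this
    omega
  | succ m ih =>
    obtain ⟨W, hW⟩ := hG.connected.exists_walk_length_eq_dist b x
    obtain ⟨s, hbs, hs⟩ : ∃ s, G.Adj b s ∧ G.dist s x = m := by
      cases W with
      | nil => simp at hm
      | @cons _ s _ h r =>
        refine ⟨s, h, ?_⟩
        have h1 := dist_le r
        have h2 := hG.connected.dist_triangle (u := b) (v := s) (w := x)
        have h3 := dist_eq_one_iff_adj.2 h
        simp only [Walk.length_cons] at hW
        omega
    have hside : ∀ z, (G.deleteEdges {s(b, s)}).Reachable s z → G.dist b z = 1 + G.dist s z :=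
      fun z hz => by
        simpa using dist_eq_of_reachable_deleteEdges hG hbs (Reachable.refl b) hz
    have hx : (G.deleteEdges {s(b, s)}).Reachable s x := by
      rw [Sym2.eq_swap]
      exact reachable_deleteEdges_of_dist_le hG.connected hbs.symm
        (by rw [SimpleGraph.dist_comm, hs, SimpleGraph.dist_comm, hm]; omega)
    have hIH := ih s hs
    have hpb := dist_comm (G := G) (u := p) (v := b)
    have hqb := dist_comm (G := G) (u := q) (v := b)
    have hpx := dist_comm (G := G) (u := p) (v := x)
    have hqx := dist_comm (G := G) (u := q) (v := x)
    have hpq := dist_comm (G := G) (u := p) (v := q)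
    rcases reachable_deleteEdges_or hG.connected hbs p with hp | hp <;>
    rcases reachable_deleteEdges_or hG.connected hbs q with hq | hq
    · have h1 := dist_eq_of_reachable_deleteEdges hG hbs hp hx
      have h2 := dist_eq_of_reachable_deleteEdges hG hbs hq hx
      have h3 := hG.connected.dist_triangle (u := p) (v := b) (w := q)
      omega
    · have h1 := dist_eq_of_reachable_deleteEdges hG hbs hp hx
      have h2 := dist_eq_of_reachable_deleteEdges hG hbs hp hq
      have h3 := hside q hq
      omega
    · have h1 := dist_eq_of_reachable_deleteEdges hG hbs hq hx
      have h2 := dist_eq_of_reachable_deleteEdges hG hbs hq hp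
      have h3 := hside p hp
      omega
    · have h2 := hside q hq
      have h3 := hside p hp
      omega

end Tree

/-! ### Eccentricities under a swap -/

section Ecc

variable {V : Type} [Fintype V]

/-- The eccentricity of a point with respect to a `ℕ`-valued distance function. -/
def ecc (d : V → V → ℕ) (x : V) : ℕ := Finset.univ.sup (d x)

/-- The diameter of a `ℕ`-valued distance function. -/
def diameter (d : V → V → ℕ) : ℕ := Finset.univ.sup (ecc d)

lemma le_ecc (d : V → V → ℕ) (x y : V) : d x y ≤ ecc d x :=
  Finset.le_sup (f := d x) (Finset.mem_univ y)

lemma ecc_le_diameter (d : V → V → ℕ) (x : V) : ecc d x ≤ diameter d :=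
  Finset.le_sup (f := ecc d) (Finset.mem_univ x)

lemma exists_eq_ecc (d : V → V → ℕ) (x : V) : ∃ y, d x y = ecc d x := by
  obtain ⟨y, -, hy⟩ := Finset.exists_mem_eq_sup Finset.univ ⟨x, Finset.mem_univ x⟩ (d x)
  exact ⟨y, hy.symm⟩

lemma exists_ecc_eq_diameter [Nonempty V] (d : V → V → ℕ) : ∃ x, ecc d x = diameter d := by
  obtain ⟨y, -, hy⟩ := Finset.exists_mem_eq_sup Finset.univ Finset.univ_nonempty (ecc d)
  exact ⟨y, hy.symm⟩

/-- `d` and `d'` are the distances of two trees obtained by joining two trees, one on `A` and one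
on its complement, by the edge `{u, v}` and by the edge `{u, w}` respectively. -/
structure CutSwap (d d' : V → V → ℕ) (A : V → Prop) (u v w : V) : Prop where
  mem : A u
  notMem : ¬ A v
  notMem' : ¬ A w
  inside : ∀ x y, A x → A y → d' x y = d x y
  outside : ∀ x y, ¬ A x → ¬ A y → d' x y = d x y
  cross : ∀ x y, A x → ¬ A y → d x y = d x u + 1 + d v y
  cross' : ∀ x y, A x → ¬ A y → d' x y = d x u + 1 + d w y
  self : ∀ x, d x x = 0
  symm : ∀ x y, d x y = d y x
  symm' : ∀ x y, d' x y = d' y x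
  triangle : ∀ x y z, d x z ≤ d x y + d y z

namespace CutSwap

variable {d d' : V → V → ℕ} {A : V → Prop} {u v w : V}

lemma exists_far (h : CutSwap d d' A u v w) (hu : ecc d' u < ecc d u) :
    ∃ y, ¬ A y ∧ (∀ z, A z → d u z < 1 + d v y) ∧ ∀ z, ¬ A z → d w z < d v y := by
  obtain ⟨y, hy⟩ := exists_eq_ecc d u
  have hlt : ∀ z, d' u z < d u y := fun z => (le_ecc d' u z).trans_lt (hy ▸ hu)
  have hyA : ¬ A y := fun hA => by
    have := hlt y
    rw [h.inside u y h.mem hA] at this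
    omega
  have hc := h.cross u y h.mem hyA
  have hs := h.self u
  refine ⟨y, hyA, fun z hz => ?_, fun z hz => ?_⟩
  · have := hlt z
    rw [h.inside u z h.mem hz] at this
    omega
  · have := hlt z
    rw [h.cross' u z h.mem hz] at this
    omega

lemma ecc_lt (h : CutSwap d d' A u v w) (hu : ecc d' u < ecc d u) {a : V} (ha : A a) :
    ecc d' a < ecc d a := by
  obtain ⟨y, hy, h1, h2⟩ := h.exists_far hu
  obtain ⟨z, hz⟩ := exists_eq_ecc d' a
  have hc := h.cross a y ha hy
  have hle := le_ecc d a y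
  by_cases hA : A z
  · have := h.inside a z ha hA
    have := h.triangle a u z
    have := h1 z hA
    omega
  · have := h.cross' a z ha hA
    have := h2 z hA
    omega

lemma exists_threshold (h : CutSwap d d' A u v w) (hu : ecc d' u < ecc d u) :
    ∃ x, A x ∧ ∀ b, ¬ A b → ecc d' b ≤ ecc d b ∨ ecc d' b < ecc d x := by
  classical
  obtain ⟨y, hy, h1, h2⟩ := h.exists_far hu
  obtain ⟨x, hx, hmax⟩ := Finset.exists_max_image (Finset.univ.filter A) (fun x => d x u)
    ⟨u, by simpa using h.mem⟩
  simp only [Finset.mem_filter, Finset.mem_univ, true_and] at hx hmax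
  refine ⟨x, hx, fun b hb => ?_⟩
  obtain ⟨z, hz⟩ := exists_eq_ecc d' b
  by_cases hA : A z
  · right
    have := hmax z hA
    have := h.symm' b z
    have := h.cross' z b hA hb
    have := h2 b hb
    have := h.cross x y hx hy
    have := le_ecc d x y
    omega
  · left
    have := h.outside b z hb hA
    have := le_ecc d b z
    omega

lemma diameter_le_and_ecc_le (h : CutSwap d d' A u v w) (hu : ecc d' u < ecc d u)
    (hfour : ∀ p q x b, d' b x + d' p q ≤ max (d' b p + d' x q) (d' b q + d' x p)) :
    diameter d' ≤ diameter d ∧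
      (diameter d' = diameter d → ∀ x, ecc d' x ≤ ecc d x) := by
  have : Nonempty V := ⟨u⟩
  obtain ⟨p, hp⟩ := exists_ecc_eq_diameter d'
  obtain ⟨q, hq⟩ := exists_eq_ecc d' p
  have hA : ∀ a, A a → ecc d' a < diameter d := fun a ha =>
    (h.ecc_lt hu ha).trans_le (ecc_le_diameter d a)
  have hqp := h.symm' p q
  have hqe := le_ecc d' q p
  by_cases hpA : A p
  · have := hA p hpA
    exact ⟨by omega, by omega⟩
  by_cases hqA : A q
  · have := hA q hqA
    exact ⟨by omega, by omega⟩
  have hout := h.outside p q hpA hqA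
  have hle := le_ecc d p q
  have hle' := ecc_le_diameter d p
  refine ⟨by omega, fun _ b => ?_⟩
  by_cases hb : A b
  · exact (h.ecc_lt hu hb).le
  obtain ⟨x, hx⟩ := exists_eq_ecc d' b
  have h1 := hfour p q x b
  have h2 := (le_ecc d' x p).trans (ecc_le_diameter d' x)
  have h3 := (le_ecc d' x q).trans (ecc_le_diameter d' x)
  have h4 := h.outside b p hb hpA
  have h5 := h.outside b q hb hqA
  have h6 := le_ecc d b p
  have h7 := le_ecc d b q
  omega

end CutSwap

end Ecc

/-! ### Swaps in trees -/

section Swap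

variable {V : Type} {G : SimpleGraph V}

lemma swapGraph_eq_sup {u v w : V} :
    swapGraph G u v w = G.deleteEdges {s(u, v)} ⊔ edge u w := by
  ext a b
  have hab : G.Adj a b → a ≠ b := Adj.ne
  simp only [swapGraph, fromEdgeSet_adj, sup_adj, deleteEdges_adj, edge_adj, Set.mem_union,
    Set.mem_sdiff, Set.mem_singleton_iff, mem_edgeSet, Sym2.eq_iff]
  tauto

lemma swapGraph_deleteEdges {u v w : V} (huw : ¬ G.Adj u w) :
    (swapGraph G u v w).deleteEdges {s(u, w)} = G.deleteEdges {s(u, v)} := by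
  rw [swapGraph_eq_sup]
  ext a b
  have hab : G.Adj a b → ¬ s(a, b) = s(u, w) := fun h he => by
    rw [← mem_edgeSet, he, mem_edgeSet] at h
    exact huw h
  simp only [deleteEdges_adj, sup_adj, edge_adj, Set.mem_singleton_iff] at *
  have : (a = u ∧ b = w ∨ a = w ∧ b = u) ↔ s(a, b) = s(u, w) := by simp
  tauto

lemma swapGraph_connected {u v w : V} (h : cMax (swapGraph G u v w) u < cMax G u) :
    (swapGraph G u v w).Connected := by
  have hreach : ∀ x, (swapGraph G u v w).Reachable u x := fun x =>
    edist_ne_top_iff_reachable.1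
      ((le_iSup (fun y => (swapGraph G u v w).edist u y) x).trans_lt (h.trans_le le_top)).ne
  have : Nonempty V := ⟨u⟩
  exact ⟨fun x y => (hreach x).symm.trans (hreach y)⟩

lemma not_reachable_of_swapGraph_connected (hG : G.IsTree) {u v w : V} (huv : G.Adj u v)
    (h : (swapGraph G u v w).Connected) : ¬ (G.deleteEdges {s(u, v)}).Reachable u w := by
  intro hr
  refine not_reachable_deleteEdges hG huv ?_
  obtain ⟨p⟩ := h u v
  have hstep : ∀ a b, (swapGraph G u v w).Adj a b →
      (G.deleteEdges {s(u, v)}).Reachable a b := fun a b hab => by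
    rw [swapGraph_eq_sup, sup_adj] at hab
    rcases hab with hab | hab
    · exact hab.reachable
    · rw [edge_adj] at hab
      rcases hab.1 with ⟨rfl, rfl⟩ | ⟨rfl, rfl⟩
      · exact hr
      · exact hr.symm
  have hwalk : ∀ a b, (swapGraph G u v w).Walk a b →
      (G.deleteEdges {s(u, v)}).Reachable a b := fun a b q => by
    induction q with
    | nil => exact .rfl
    | cons hadj _ ih => exact (hstep _ _ hadj).trans ih
  exact hwalk u v p

variable [Fintype V]

lemma cMax_eq_ecc (hG : G.Connected) (x : V) : cMax G x = (ecc G.dist x : ℕ∞) := by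
  have hd : ∀ y, G.edist x y = (G.dist x y : ℕ∞) := fun y => (hG x y).coe_dist_eq_edist.symm
  refine le_antisymm (iSup_le fun y => ?_) ?_
  · rw [hd]
    exact_mod_cast le_ecc G.dist x y
  · obtain ⟨y, hy⟩ := exists_eq_ecc G.dist x
    rw [← hy, ← hd]
    exact le_iSup (fun y => G.edist x y) y

lemma UnhappyMaxVia.cMax_lt (hG : G.Connected) {k : ℕ} {u v w : V}
    (h : UnhappyMaxVia G k u v w) : cMax (swapGraph G u v w) u < cMax G u :=
  h.2 V G id ⟨inferInstance, hG, Set.injOn_id _, by simp [ball], fun _ _ _ _ => Iff.rfl⟩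

lemma UnhappyMaxVia.isTree_swapGraph (hG : G.IsTree) {k : ℕ} {u v w : V}
    (h : UnhappyMaxVia G k u v w) : (swapGraph G u v w).IsTree := by
  have hc := swapGraph_connected (h.cMax_lt hG.connected)
  refine ⟨hc, ?_⟩
  have hnot := not_reachable_of_swapGraph_connected hG h.1.1 hc
  rw [swapGraph_eq_sup]
  exact (hG.isAcyclic.anti (deleteEdges_le _)).sup_edge_of_not_reachable hnot

lemma UnhappyMaxVia.ecc_lt (hG : G.IsTree) {k : ℕ} {u v w : V}
    (h : UnhappyMaxVia G k u v w) : ecc (swapGraph G u v w).dist u < ecc G.dist u := by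
  have hlt := h.cMax_lt hG.connected
  rw [cMax_eq_ecc hG.connected, cMax_eq_ecc (h.isTree_swapGraph hG).connected] at hlt
  exact_mod_cast hlt

lemma UnhappyMaxVia.cutSwap (hG : G.IsTree) {k : ℕ} {u v w : V} (h : UnhappyMaxVia G k u v w) :
    CutSwap G.dist (swapGraph G u v w).dist (fun x => (G.deleteEdges {s(u, v)}).Reachable u x)
      u v w := by
  have hT := h.isTree_swapGraph hG
  obtain ⟨⟨huv, -, huw, hwu⟩, -⟩ := h
  have huw' : (swapGraph G u v w).Adj u w := by
    rw [swapGraph_eq_sup, sup_adj, edge_adj]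
    exact .inr ⟨.inl ⟨rfl, rfl⟩, hwu.symm⟩
  have hK := swapGraph_deleteEdges (v := v) huw
  have hle : G.deleteEdges {s(u, v)} ≤ swapGraph G u v w := hK ▸ deleteEdges_le _
  have hsame : ∀ x y, (G.deleteEdges {s(u, v)}).Reachable x y →
      (swapGraph G u v w).dist x y = G.dist x y := fun x y hxy => by
    rw [dist_eq_of_le_of_reachable hT.isAcyclic hle hxy,
      dist_eq_of_le_of_reachable hG.isAcyclic (deleteEdges_le _) hxy]
  have hv : ∀ x, ¬ (G.deleteEdges {s(u, v)}).Reachable u x →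
      (G.deleteEdges {s(u, v)}).Reachable v x := fun x hx =>
    (reachable_deleteEdges_or hG.connected huv x).resolve_left hx
  have hnw := not_reachable_of_swapGraph_connected hG huv hT.connected
  refine
    { mem := .rfl
      notMem := not_reachable_deleteEdges hG huv
      notMem' := hnw
      inside := fun x y hx hy => hsame x y (hx.symm.trans hy)
      outside := fun x y hx hy => hsame x y ((hv x hx).symm.trans (hv y hy))
      cross := fun x y hx hy => dist_eq_of_reachable_deleteEdges hG huv hx (hv y hy)
      cross' := fun x y hx hy => ?_
      self := fun x => dist_self
      symm := fun x y => dist_comm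
      symm' := fun x y => dist_comm
      triangle := fun x y z => hG.connected.dist_triangle }
  have hwy := (hv w hnw).symm.trans (hv y hy)
  rw [← hsame x u hx.symm, ← hsame w y hwy]
  exact dist_eq_of_reachable_deleteEdges hT huw' (hK ▸ hx) (hK ▸ hwy)

end Swap

/-! ### The potential -/

/-- Comparison of two non-increasing lists through the number of entries above each threshold. -/
lemma lex_of_countP {α : Type} [LinearOrder α] (M : α) (l' l : List α)
    (hs' : l'.Pairwise (· ≥ ·)) (hs : l.Pairwise (· ≥ ·))
    (hle : ∀ t, M ≤ t → l'.countP (fun a => t ≤ a) ≤ l.countP (fun a => t ≤ a))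
    (hlt : l'.countP (fun a => M ≤ a) < l.countP (fun a => M ≤ a)) :
    List.Lex (· < ·) l' l := by
  induction l' generalizing l with
  | nil =>
    cases l with
    | nil => simp at hlt
    | cons a r => exact .nil
  | cons a' r' ih =>
    cases l with
    | nil => simp at hlt
    | cons a r =>
      rw [List.pairwise_cons] at hs hs'
      have hzero : ∀ t, a < t → (a :: r).countP (fun a => t ≤ a) = 0 := fun t ht => by
        rw [List.countP_eq_zero]
        intro b hb
        have hba : b ≤ a := by
          rcases List.mem_cons.1 hb with rfl | hb
          · exact le_rfl
          · exact hs.1 b hb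
        simpa using hba.trans_lt ht
      rcases lt_trichotomy a' a with h | rfl | h
      · exact .rel h
      · refine .cons (ih r hs'.2 hs.2 (fun t ht => ?_) ?_)
        · have := hle t ht
          simp only [List.countP_cons] at this
          omega
        · simp only [List.countP_cons] at hlt
          omega
      · exfalso
        rcases le_or_gt M a' with hM | hM
        · have := hle a' hM
          rw [hzero a' h] at this
          simp at this
        · rw [hzero M (h.trans hM)] at hlt
          omega

lemma pairwise_phiMax {W : Type} [Fintype W] (H : SimpleGraph W) :
    (phiMax H).Pairwise (· ≥ ·) := by
  rw [phiMax, List.pairwise_reverse]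
  exact Multiset.pairwise_sort _ _

lemma countP_phiMax {W : Type} [Fintype W] (H : SimpleGraph W) (t : ℕ∞) :
    (phiMax H).countP (fun a => t ≤ a) = (Finset.univ.filter fun x => t ≤ cMax H x).card := by
  rw [phiMax, List.countP_reverse, ← Multiset.coe_countP, Multiset.sort_eq, Multiset.countP_map]
  rfl

lemma UnhappyMaxVia.phiMax_lex {V : Type} [Fintype V] {G : SimpleGraph V} (hG : G.IsTree) {k : ℕ}
    {u v w : V} (h : UnhappyMaxVia G k u v w) :
    List.Lex (· < ·) (phiMax (swapGraph G u v w)) (phiMax G) := by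
  have hT := h.isTree_swapGraph hG
  have hcut := h.cutSwap hG
  have hu := h.ecc_lt hG
  obtain ⟨x, hx, hthr⟩ := hcut.exists_threshold hu
  have hmono : ∀ t, cMax G x ≤ t → ∀ y, t ≤ cMax (swapGraph G u v w) y → t ≤ cMax G y := by
    intro t ht y hy
    by_cases hyA : (G.deleteEdges {s(u, v)}).Reachable u y
    · refine hy.trans ?_
      rw [cMax_eq_ecc hG.connected, cMax_eq_ecc hT.connected]
      exact_mod_cast (hcut.ecc_lt hu hyA).le
    · rcases hthr y hyA with hb | hb
      · refine hy.trans ?_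
        rw [cMax_eq_ecc hG.connected, cMax_eq_ecc hT.connected]
        exact_mod_cast hb
      · have hle := ht.trans hy
        rw [cMax_eq_ecc hG.connected, cMax_eq_ecc hT.connected, Nat.cast_le] at hle
        omega
  refine lex_of_countP (cMax G x) _ _ (pairwise_phiMax _) (pairwise_phiMax _) (fun t ht => ?_) ?_
  · rw [countP_phiMax, countP_phiMax]
    exact Finset.card_le_card (Finset.monotone_filter_right _ fun y _ => hmono t ht y)
  · rw [countP_phiMax, countP_phiMax]
    refine Finset.card_lt_card (Finset.ssubset_iff_of_subset
      (Finset.monotone_filter_right _ fun y _ => hmono _ le_rfl y) |>.2 ⟨x, by simp, ?_⟩)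
    simp only [Finset.mem_filter, Finset.mem_univ, true_and, not_le]
    rw [cMax_eq_ecc hG.connected, cMax_eq_ecc hT.connected]
    exact_mod_cast hcut.ecc_lt hu hx

/-- A natural-number potential for swaps: the diameter, weighted so that it dominates the
sum of all eccentricities, plus that sum. -/
def potential {V : Type} [Fintype V] (d : V → V → ℕ) : ℕ :=
  diameter d * (Fintype.card V ^ 2 + 1) + ∑ x, ecc d x

lemma ecc_dist_le_card {V : Type} [Fintype V] {G : SimpleGraph V} (hG : G.Connected) (x : V) :
    ecc G.dist x ≤ Fintype.card V :=
  Finset.sup_le fun y _ => by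
    obtain ⟨p, hp, hl⟩ := hG.exists_path_of_dist x y
    exact hl ▸ hp.length_lt.le

lemma sum_ecc_dist_le {V : Type} [Fintype V] {G : SimpleGraph V} (hG : G.Connected) :
    ∑ x, ecc G.dist x ≤ Fintype.card V ^ 2 := by
  refine (Finset.sum_le_card_nsmul _ _ _ fun x _ => ecc_dist_le_card hG x).trans ?_
  simp [sq]

lemma potential_le {V : Type} [Fintype V] {G : SimpleGraph V} (hG : G.Connected) :
    potential G.dist ≤ 3 * Fintype.card V ^ 3 := by
  have := hG.nonempty
  have hn : 1 ≤ Fintype.card V := Fintype.card_pos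
  have hD : diameter G.dist ≤ Fintype.card V := Finset.sup_le fun x _ => ecc_dist_le_card hG x
  have hS := sum_ecc_dist_le hG
  have h1 := Nat.mul_le_mul_right (Fintype.card V ^ 2 + 1) hD
  have h2 : Fintype.card V ^ 2 ≤ Fintype.card V ^ 3 := Nat.pow_le_pow_right hn (by norm_num)
  have h3 : Fintype.card V ≤ Fintype.card V ^ 3 := Nat.le_self_pow (by norm_num) _
  have h4 : Fintype.card V * (Fintype.card V ^ 2 + 1) = Fintype.card V ^ 3 + Fintype.card V := by
    ring
  unfold potential
  omega

lemma UnhappyMaxVia.potential_lt {V : Type} [Fintype V] {G : SimpleGraph V} (hG : G.IsTree)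
    {k : ℕ} {u v w : V} (h : UnhappyMaxVia G k u v w) :
    potential (swapGraph G u v w).dist < potential G.dist := by
  have hT := h.isTree_swapGraph hG
  have hu := h.ecc_lt hG
  obtain ⟨hle, heq⟩ := (h.cutSwap hG).diameter_le_and_ecc_le hu (four_point hT)
  have hS := sum_ecc_dist_le hT.connected
  unfold potential
  rcases hle.eq_or_lt with hD | hD
  · rw [hD]
    exact Nat.add_lt_add_left
      (Finset.sum_lt_sum (fun x _ => heq hD x) ⟨u, Finset.mem_univ u, hu⟩) _
  · have := Nat.mul_le_mul_right (Fintype.card V ^ 2 + 1) (Nat.succ_le_of_lt hD)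
    rw [Nat.succ_mul] at this
    omega

theorem stmt5 :
    (∀ (k : ℕ), 1 ≤ k → ∀ (V : Type) [Fintype V], ∀ (G : SimpleGraph V), G.IsTree →
      ∀ u v w : V, UnhappyMaxVia G k u v w →
        (swapGraph G u v w).IsTree ∧
        List.Lex (· < ·) (phiMax (swapGraph G u v w)) (phiMax G)) ∧
    (∃ C : ℕ, 0 < C ∧ ∀ (k : ℕ), 1 ≤ k → ∀ (n T : ℕ) (Gs : ℕ → SimpleGraph (Fin n)),
      (Gs 0).IsTree →
      (∀ t < T, ∃ u v w, UnhappyMaxVia (Gs t) k u v w ∧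
        Gs (t + 1) = swapGraph (Gs t) u v w) →
      T ≤ C * n ^ 3) := by
  refine ⟨fun k _ V _ G hG u v w h => ⟨h.isTree_swapGraph hG, h.phiMax_lex hG⟩,
    3, by norm_num, fun k _ n T Gs h0 hstep => ?_⟩
  have key : ∀ t ≤ T, (Gs t).IsTree ∧ potential (Gs t).dist + t ≤ potential (Gs 0).dist := by
    intro t
    induction t with
    | zero => exact fun _ => ⟨h0, le_rfl⟩
    | succ t ih =>
      intro ht
      obtain ⟨hG, hpot⟩ := ih (Nat.le_of_succ_le ht)
      obtain ⟨u, v, w, h, heq⟩ := hstep t ht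
      have hlt := h.potential_lt hG
      rw [heq]
      exact ⟨h.isTree_swapGraph hG, by omega⟩
  have h1 := (key T le_rfl).2
  have h2 := potential_le h0.connected
  rw [Fintype.card_fin] at h2
  omega

end SwapGame
end

section
/- There exist constants c₁, c₂ > 0 such that for every n ≥ 13 and every k ∈ {1, 2, 3}, the price of anarchy of the SUM swap game on n-vertex trees by pessimistic players with k-local information satisfies c₁·n ≤ PoA_SUM(n, n−1, k) ≤ c₂·n. -/
open SimpleGraph

namespace SwapGame

lemma le_add_edist_of_lipschitz {W : Type} (H : SimpleGraph W) (f : W → ℕ)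
    (hf : ∀ a b, H.Adj a b → f b ≤ f a + 1) (u x : W) :
    (f x : ℕ∞) ≤ f u + H.edist u x := by
  by_cases h : H.Reachable u x
  · obtain ⟨p, hp⟩ := h.exists_walk_length_eq_edist
    rw [← hp]
    have key : ∀ {a b : W} (q : H.Walk a b), f b ≤ f a + q.length := by
      intro a b q
      induction q with
      | nil => simp
      | cons hadj q ih =>
        have := hf _ _ hadj
        rw [SimpleGraph.Walk.length_cons]
        omega
    exact_mod_cast key p
  · rw [SimpleGraph.edist_eq_top_of_not_reachable h]
    simp

lemma edist_le_succ_of_adj {W : Type} {H : SimpleGraph W} {x y z : W} {m : ℕ}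
    (h : H.edist x y ≤ (m : ℕ∞)) (hyz : H.Adj y z) : H.edist x z ≤ ((m + 1 : ℕ) : ℕ∞) := by
  refine H.edist_triangle.trans ((add_le_add h (SimpleGraph.edist_eq_one_iff_adj.2 hyz).le).trans ?_)
  push_cast
  rfl

lemma reachable_of_edist_le {W : Type} {H : SimpleGraph W} {x y : W} {m : ℕ}
    (h : H.edist x y ≤ (m : ℕ∞)) : H.Reachable x y :=
  SimpleGraph.reachable_of_edist_ne_top (ne_top_of_le_ne_top (ENat.natCast_ne_top m) h)

lemma swapGraph_adj {V : Type} (G : SimpleGraph V) (u v w x y : V) :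
    (swapGraph G u v w).Adj x y ↔
      ((G.Adj x y ∧ ¬ (x = u ∧ y = v) ∧ ¬ (x = v ∧ y = u)) ∨ (x = u ∧ y = w) ∨ (x = w ∧ y = u))
        ∧ x ≠ y := by
  simp only [swapGraph, SimpleGraph.fromEdgeSet_adj, Set.mem_union, Set.mem_sdiff,
    SimpleGraph.mem_edgeSet, Set.mem_singleton_iff, Sym2.eq_iff]
  tauto

/-- A swap that does not decrease the cost, certified by an upper bound `φ` on the distances
before the swap and a potential `ψ` bounding the distances after the swap from below. -/
lemma not_cSum_swap_lt {W : Type} [Fintype W] (H : SimpleGraph W) (u v w : W) (φ ψ : W → ℕ)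
    (hφ : ∀ x, H.edist u x ≤ (φ x : ℕ∞)) (hu : ψ u = 0)
    (hψ : ∀ x y, H.Adj x y → ¬ (x = u ∧ y = v) → ¬ (x = v ∧ y = u) → ψ y ≤ ψ x + 1)
    (hw : ψ w ≤ 1) (hle : ∑ x, φ x ≤ ∑ x, ψ x) :
    ¬ cSum (swapGraph H u v w) u < cSum H u := by
  rw [not_lt, cSum, cSum, tsum_fintype, tsum_fintype]
  calc ∑ x, H.edist u x ≤ ∑ x, (φ x : ℕ∞) := Finset.sum_le_sum fun x _ => hφ x
    _ ≤ ∑ x, (ψ x : ℕ∞) := by exact_mod_cast hle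
    _ ≤ ∑ x, (swapGraph H u v w).edist u x := by
      refine Finset.sum_le_sum fun x _ => ?_
      have := le_add_edist_of_lipschitz (swapGraph H u v w) ψ ?_ u x
      · simpa [hu] using this
      · intro a b hab
        rw [swapGraph_adj] at hab
        obtain ⟨⟨h, h1, h2⟩ | ⟨rfl, rfl⟩ | ⟨rfl, rfl⟩, _⟩ := hab
        · exact hψ a b h h1 h2
        · omega
        · omega

lemma compatible_self {V : Type} [Finite V] {G : SimpleGraph V} (hG : G.Connected) (k : ℕ)
    (u : V) : Compatible G k u G id :=
  ⟨inferInstance, hG, Function.injective_id.injOn, by simp [ball], by simp⟩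

/-- No player `u` profits from swapping away a neighbor `v` all of whose other neighbors are
leaves, provided that `v` does not have exactly one such leaf. -/
lemma not_unhappy_of_leaves {V : Type} [Fintype V] {G : SimpleGraph V} (hG : G.Connected)
    {k : ℕ} {u v w : V}
    (hv : ∀ x, G.Adj v x → x ≠ u → (∀ y, G.Adj x y → y = v) ∧ ∃ l, G.Adj v l ∧ l ≠ u ∧ l ≠ x) :
    ¬ UnhappySumVia G k u v w := by
  classical
  rintro ⟨⟨huv, -, huw, hwu⟩, h⟩
  have hvw : v ≠ w := fun h => huw (h ▸ huv)
  have hne : u ≠ v := huv.ne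
  have hd : ∀ x, G.edist u x ≤ (G.dist u x : ℕ∞) := fun x => (hG u x).coe_dist_eq_edist.ge
  have hdl : ∀ x y, G.Adj x y → G.dist u y ≤ G.dist u x + 1 := fun x y hxy => by
    have := hG.dist_triangle (u := u) (v := x) (w := y)
    rwa [SimpleGraph.dist_eq_one_iff_adj.2 hxy] at this
  refine absurd (h V G id (compatible_self hG k u)) ?_
  simp only [id]
  by_cases hw : G.Adj v w
  · obtain ⟨hwv, l, hl, hlu, hlw⟩ := hv w hw hwu
    have hd1 : G.dist u v = 1 := SimpleGraph.dist_eq_one_iff_adj.2 huv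
    refine not_cSum_swap_lt G u v w (G.dist u)
      (fun x => if x = u then 0 else if x = w then 1 else if x = v then 2 else
        if G.Adj v x then 3 else G.dist u x) hd (by simp) ?_ (by simp [hwu]) ?_
    · intro x y hxy h1 h2
      have := hdl x y hxy
      have hxy' := hxy.symm
      have h0 : G.dist u u = 0 := by simp
      grind
    · have : ∑ x, (G.dist u x + if x = v then 1 else 0) ≤
          ∑ x, ((if x = u then 0 else if x = w then 1 else if x = v then 2 else
        if G.Adj v x then 3 else G.dist u x) + if x = w then 1 else 0) := by
        refine Finset.sum_le_sum fun x _ => ?_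
        have h0 : G.dist u u = 0 := by simp
        have := hdl v x
        grind
      rw [Finset.sum_add_distrib, Finset.sum_add_distrib] at this
      simpa using this
  · refine not_cSum_swap_lt G u v w (G.dist u)
      (fun x => if x = v then ∑ x, G.dist u x else if x ≠ u ∧ G.Adj v x then ∑ x, G.dist u x else 0)
      hd (by simp [hne]) ?_ (by simp [hvw.symm, hw]) ?_
    · intro x y hxy h1 h2
      have hxy' := hxy.symm
      grind
    · exact (by simp : (∑ x, G.dist u x) = _).trans_le
        (Finset.single_le_sum (f := fun x => if x = v then ∑ x, G.dist u x else
          if x ≠ u ∧ G.Adj v x then ∑ x, G.dist u x else 0)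
        (fun _ _ => Nat.zero_le _) (Finset.mem_univ v))

/-- The vertices in the component of `b` after removing the vertex `v`. -/
def branch {V : Type} (G : SimpleGraph V) (v b : V) : Set V :=
  {x | (G.deleteIncidenceSet v).Reachable b x}

lemma mem_branch_self {V : Type} (G : SimpleGraph V) (v b : V) : b ∈ branch G v b :=
  SimpleGraph.Reachable.refl b

lemma mem_branch_of_adj {V : Type} {G : SimpleGraph V} {v b x y : V} (h : G.Adj x y)
    (hx : x ≠ v) (hy : y ≠ v) (hb : x ∈ branch G v b) : y ∈ branch G v b :=
  hb.trans (SimpleGraph.deleteIncidenceSet_adj.2 ⟨h, hx, hy⟩).reachable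

lemma eq_of_mem_branch {V : Type} {G : SimpleGraph V} (hG : G.IsAcyclic) {v b c : V}
    (hb : G.Adj v b) (hc : G.Adj v c) (h : c ∈ branch G v b) : c = b := by
  by_contra hne
  have hbr := SimpleGraph.isAcyclic_iff_forall_adj_isBridge.1 hG hb
  rw [SimpleGraph.isBridge_iff] at hbr
  have hle : G.deleteIncidenceSet v ≤ G.deleteEdges {s(v, b)} := by
    intro x y hxy
    rw [SimpleGraph.deleteIncidenceSet_adj] at hxy
    rw [SimpleGraph.deleteEdges_adj]
    refine ⟨hxy.1, ?_⟩
    rw [Set.mem_singleton_iff, Sym2.eq_iff]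
    have := hxy.2
    tauto
  have h1 : (G.deleteEdges {s(v, b)}).Adj v c := by
    rw [SimpleGraph.deleteEdges_adj]
    refine ⟨hc, ?_⟩
    rw [Set.mem_singleton_iff, Sym2.eq_iff]
    have := hc.ne
    tauto
  exact hbr (h1.reachable.trans (SimpleGraph.Reachable.mono hle h).symm)

/-- The graph `G` with `M` additional leaves attached to the vertex `c`. -/
def attachLeaves {V : Type} (G : SimpleGraph V) (c : V) (M : ℕ) : SimpleGraph (V ⊕ Fin M) where
  Adj x y := match x, y with
    | .inl a, .inl b => G.Adj a b
    | .inl a, .inr _ => a = c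
    | .inr _, .inl b => b = c
    | .inr _, .inr _ => False
  symm := ⟨fun x y h => by
    rcases x with x | x <;> rcases y with y | y <;> first | exact h.symm | exact h⟩
  loopless := ⟨fun x h => by
    rcases x with x | x
    · exact G.loopless.irrefl _ h
    · exact h⟩

lemma attachLeaves_edist_inl_le {V : Type} (G : SimpleGraph V) (c : V) (M : ℕ) (x y : V) :
    (attachLeaves G c M).edist (.inl x) (.inl y) ≤ G.edist x y := by
  by_cases h : G.Reachable x y
  · obtain ⟨p, hp⟩ := h.exists_walk_length_eq_edist
    let g : G →g attachLeaves G c M := ⟨Sum.inl, fun h => h⟩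
    rw [← hp, ← SimpleGraph.Walk.length_map g p]
    exact SimpleGraph.edist_le (p.map g)
  · rw [SimpleGraph.edist_eq_top_of_not_reachable h]
    exact le_top

lemma attachLeaves_le_edist {V : Type} {G : SimpleGraph V} (hG : G.Connected) (c : V) (M : ℕ)
    (u : V) (x : V ⊕ Fin M) :
    ((Sum.elim (G.dist u) (fun _ => G.dist u c + 1) x : ℕ) : ℕ∞) ≤
      (attachLeaves G c M).edist (.inl u) x := by
  have hdl : ∀ x y, G.Adj x y → G.dist u y ≤ G.dist u x + 1 := fun x y hxy => by
    have := hG.dist_triangle (u := u) (v := x) (w := y)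
    rwa [SimpleGraph.dist_eq_one_iff_adj.2 hxy] at this
  have := le_add_edist_of_lipschitz (attachLeaves G c M)
    (Sum.elim (G.dist u) (fun _ => G.dist u c + 1)) ?_ (.inl u) x
  · simpa using this
  · rintro (a | a) (b | b) hab
    · exact hdl a b hab
    · obtain rfl : a = c := hab
      simp
    · obtain rfl : b = c := hab
      simp
      omega
    · exact hab.elim

lemma attachLeaves_edist_le {V : Type} {G : SimpleGraph V} (hG : G.Connected) (c : V) (M : ℕ)
    (u : V) (x : V ⊕ Fin M) :
    (attachLeaves G c M).edist (.inl u) x ≤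
      ((Sum.elim (G.dist u) (fun _ => G.dist u c + 1) x : ℕ) : ℕ∞) := by
  have h : ∀ y, (attachLeaves G c M).edist (.inl u) (.inl y) ≤ (G.dist u y : ℕ∞) := fun y =>
    (attachLeaves_edist_inl_le G c M u y).trans (hG u y).coe_dist_eq_edist.ge
  rcases x with x | x
  · exact h x
  · exact edist_le_succ_of_adj (h c) (rfl : c = c)

lemma attachLeaves_compatible {V : Type} [Finite V] {G : SimpleGraph V} (hG : G.Connected)
    {c : V} (M : ℕ) {u : V} {k : ℕ} (hk : k ≤ G.dist u c) :
    Compatible G k u (attachLeaves G c M) Sum.inl := by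
  refine ⟨inferInstance, ?_, Sum.inl_injective.injOn, ?_, fun a _ b _ => Iff.rfl⟩
  · exact (SimpleGraph.connected_iff_exists_forall_reachable _).2
      ⟨.inl u, fun x => reachable_of_edist_le (attachLeaves_edist_le hG c M u x)⟩
  · ext x
    rcases x with x | x
    · simp only [ball, Set.mem_ofPred_eq, Set.mem_image, Sum.inl.injEq, exists_eq_right]
      refine ⟨fun h => ?_, (attachLeaves_edist_inl_le G c M u x).trans⟩
      rw [← (hG u x).coe_dist_eq_edist]
      exact (attachLeaves_le_edist hG c M u (.inl x)).trans h
    · simp only [ball, Set.mem_ofPred_eq, Set.mem_image, reduceCtorEq, and_false, exists_false,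
        iff_false, not_le]
      refine lt_of_lt_of_le ?_ (attachLeaves_le_edist hG c M u (.inr x))
      simp only [Sum.elim_inr]
      exact_mod_cast Nat.lt_succ_of_le hk

/-- No player `u` profits from swapping away a neighbor `v` that has two further neighbors which
are not leaves: one of them leads to vertices outside the view of `u` that may be numerous. -/
lemma not_unhappy_of_junction {V : Type} [Fintype V] {G : SimpleGraph V} (hG : G.IsTree)
    {k : ℕ} (hk : k ≤ 3) {u v w b₁ b₂ c₁ c₂ : V} (h₁ : G.Adj v b₁) (h₂ : G.Adj v b₂)
    (hne : b₁ ≠ b₂) (hu₁ : b₁ ≠ u) (hu₂ : b₂ ≠ u) (hc₁ : G.Adj b₁ c₁) (hc₂ : G.Adj b₂ c₂)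
    (hv₁ : c₁ ≠ v) (hv₂ : c₂ ≠ v) :
    ¬ UnhappySumVia G k u v w := by
  classical
  rintro ⟨⟨huv, -, huw, hwu⟩, h⟩
  have hvw : w ≠ v := fun h => huw (h ▸ huv)
  obtain ⟨b, c, hb, hc, hbu, hcv, hwb⟩ : ∃ b c, G.Adj v b ∧ G.Adj b c ∧ b ≠ u ∧ c ≠ v ∧
      w ∉ branch G v b := by
    by_cases hw : w ∈ branch G v b₁
    · refine ⟨b₂, c₂, h₂, hc₂, hu₂, hv₂, fun hw' => hne ?_⟩
      exact (eq_of_mem_branch hG.2 h₁ h₂ (hw.trans (SimpleGraph.Reachable.symm hw'))).symm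
    · exact ⟨b₁, c₁, h₁, hc₁, hu₁, hv₁, hw⟩
  have hGc := hG.1
  have hbb := mem_branch_self G v b
  have hcb : c ∈ branch G v b := mem_branch_of_adj hc hb.ne' hcv hbb
  have heq : ∀ y, G.Adj v y → y ∈ branch G v b → y = b := fun y hy =>
    eq_of_mem_branch hG.2 hb hy
  have hmem : ∀ x y, G.Adj x y → x ≠ v → y ≠ v → x ∈ branch G v b → y ∈ branch G v b :=
    fun x y => mem_branch_of_adj
  have hub : u ∉ branch G v b := fun hu => hbu (heq u huv.symm hu).symm
  have hcu : c ≠ u := fun h => hub (h ▸ hcb)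
  have huv' := huv.ne
  have hbc := hc.ne
  have hbv := hb.ne
  have hd3 : 3 ≤ G.dist u c := by
    have := le_add_edist_of_lipschitz G (fun x => if x = v then 1 else if x = b then 2 else
      if x ∈ branch G v b then 3 else 0) ?_ u c
    · rw [← (hGc u c).coe_dist_eq_edist] at this
      simpa [huv', hcv, hbc.symm, hcb, hub, hbu.symm] using this
    · intro x y hxy
      have hyx := hxy.symm
      grind
  have hd3' : G.dist u c ≤ 3 := by
    have h1 := edist_le_succ_of_adj (m := 1) (SimpleGraph.edist_eq_one_iff_adj.2 huv).le hb
    have h2 := edist_le_succ_of_adj h1 hc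
    rw [← (hGc u c).coe_dist_eq_edist] at h2
    exact_mod_cast h2
  set C := ∑ x, G.dist u x with hC
  refine absurd (h _ _ Sum.inl (attachLeaves_compatible hGc C (hk.trans hd3))) ?_
  refine not_cSum_swap_lt _ _ _ _ _ (Sum.elim (fun x => if x = u then 0 else
    if x = v then 2 else if x = b then 3 else if x ∈ branch G v b then 4 else 1) (fun _ => 5))
    (attachLeaves_edist_le hGc c C u) (by simp) ?_ ?_ ?_
  · rintro (x | x) (y | y) hxy h1 h2
    · simp only [Sum.inl.injEq] at h1 h2
      have hxy : G.Adj x y := hxy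
      have hyx := hxy.symm
      simp only [Sum.elim_inl]
      grind
    · obtain rfl : x = c := hxy
      simp only [Sum.elim_inl, Sum.elim_inr]
      grind
    · obtain rfl : y = c := hxy
      simp only [Sum.elim_inl, Sum.elim_inr]
      grind
    · exact hxy.elim
  · simp only [Sum.elim_inl]
    grind
  · rw [Fintype.sum_sum_type, Fintype.sum_sum_type]
    simp only [Sum.elim_inl, Sum.elim_inr, Finset.sum_const, Finset.card_univ, Fintype.card_fin,
      smul_eq_mul, ← hC]
    have : C * (G.dist u c + 1) ≤ C * 4 := Nat.mul_le_mul_left _ (by omega)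
    omega


/-- A leaf `u` of a star with center `v` does not profit from any swap if the star has at least
two further leaves and its only connection to the rest of the graph is a vertex `z` of degree
three. -/
lemma not_unhappy_of_star_leaf {V : Type} [Finite V] {G : SimpleGraph V}
    {k : ℕ} (hk : k ≤ 3) {u v w z a b l₁ l₂ : V} (huv : G.Adj u v) (hvz : G.Adj v z)
    (hza : G.Adj z a) (hzb : G.Adj z b) (hab : a ≠ b) (hav : a ≠ v) (hbv : b ≠ v)
    (hnab : ¬ G.Adj a b) (huz : u ≠ z)
    (hv : ∀ x, G.Adj v x → x ≠ z → ∀ y, G.Adj x y → y = v)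
    (hz : ∀ y, G.Adj z y → y = v ∨ y = a ∨ y = b)
    (hl₁ : G.Adj v l₁) (hl₂ : G.Adj v l₂) (hl : l₁ ≠ l₂) (hlu₁ : l₁ ≠ u) (hlu₂ : l₂ ≠ u)
    (hlz₁ : l₁ ≠ z) (hlz₂ : l₂ ≠ z) :
    ¬ UnhappySumVia G k u v w := by
  classical
  rintro ⟨⟨-, hwk, huw, hwu⟩, h⟩
  have hvw : w ≠ v := fun h => huw (h ▸ huv)
  have hnva : ¬ G.Adj v a := fun h => by
    have := hv a h hza.ne' z hza.symm
    exact hvz.ne this.symm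
  have hnvb : ¬ G.Adj v b := fun h => by
    have := hv b h hzb.ne' z hzb.symm
    exact hvz.ne this.symm
  have hu : ∀ y, G.Adj u y → y = v := hv u huv.symm huz
  have hne := huv.ne
  have hvz' := hvz.ne
  have hza' := hza.ne
  have hzb' := hzb.ne
  have hvu := huv.symm
  have hau : a ≠ u := fun h => hnva (h ▸ huv.symm)
  have hbu : b ≠ u := fun h => hnvb (h ▸ huv.symm)
  have hnvv : ¬ G.Adj v v := G.loopless.irrefl v
  let φ : V → ℕ := fun x => if x = u then 0 else if x = v then 1 else if x = a then 3 else
    if x = b then 3 else if G.Adj v x then 2 else 4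
  have hφle : ∀ x, (φ x : ℕ∞) ≤ G.edist u x := by
    intro x
    have := le_add_edist_of_lipschitz G φ ?_ u x
    · simpa [φ] using this
    · intro x y hxy
      have hyx := hxy.symm
      simp only [φ]
      by_cases hxz : x = z <;> by_cases hvx : G.Adj v x <;> grind
  let B : Set V := {x | φ x ≤ 3}
  have hB : ∀ x, x ∈ B ↔ x = u ∨ x = v ∨ x = a ∨ x = b ∨ G.Adj v x := by
    intro x
    change φ x ≤ 3 ↔ _
    simp only [φ]
    grind
  have huB : u ∈ B := by simp [hB]
  have hvB : v ∈ B := by simp [hB]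
  have haB : a ∈ B := by simp [hB]
  have hbB : b ∈ B := by simp [hB]
  have hzB : z ∈ B := by simp [hB, hvz]
  have hlB₁ : l₁ ∈ B := by simp [hB, hl₁]
  have hlB₂ : l₂ ∈ B := by simp [hB, hl₂]
  let H : SimpleGraph B := G.induce B
  have hH : ∀ x y : B, H.Adj x y ↔ G.Adj x y := fun x y => Iff.rfl
  have hleφ : ∀ x : B, H.edist ⟨u, huB⟩ x ≤ (φ x : ℕ∞) := by
    have h1 : H.edist ⟨u, huB⟩ ⟨v, hvB⟩ ≤ ((1 : ℕ) : ℕ∞) :=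
      (SimpleGraph.edist_eq_one_iff_adj.2 ((hH _ _).2 huv)).le
    have h2 : ∀ x (hx : x ∈ B), G.Adj v x → H.edist ⟨u, huB⟩ ⟨x, hx⟩ ≤ ((2 : ℕ) : ℕ∞) :=
      fun x hx hvx => edist_le_succ_of_adj h1 ((hH _ _).2 hvx)
    have ha3 : H.edist ⟨u, huB⟩ ⟨a, haB⟩ ≤ ((3 : ℕ) : ℕ∞) :=
      edist_le_succ_of_adj (h2 z hzB hvz) ((hH _ _).2 hza)
    have hb3 : H.edist ⟨u, huB⟩ ⟨b, hbB⟩ ≤ ((3 : ℕ) : ℕ∞) :=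
      edist_le_succ_of_adj (h2 z hzB hvz) ((hH _ _).2 hzb)
    rintro ⟨x, hx⟩
    by_cases hxu : x = u
    · subst hxu; simp
    by_cases hxv : x = v
    · subst hxv; simpa [φ, hxu] using h1
    by_cases hxa : x = a
    · subst hxa; simpa [φ, hxu, hxv] using ha3
    by_cases hxb : x = b
    · subst hxb; simpa [φ, hxu, hxv, hxa] using hb3
    have hvx : G.Adj v x := by
      have := (hB x).1 hx
      tauto
    simpa [φ, hxu, hxv, hxa, hxb, hvx] using h2 x hx hvx
  let ι : V → B := fun x => if hx : x ∈ B then ⟨x, hx⟩ else ⟨u, huB⟩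
  have hι : ∀ x (hx : x ∈ B), ι x = ⟨x, hx⟩ := fun x hx => by simp [ι, hx]
  have hball : ∀ x, G.edist u x ≤ (k : ℕ∞) → x ∈ B := fun x hx => by
    have := (hφle x).trans hx
    have : φ x ≤ k := by exact_mod_cast this
    exact this.trans hk
  have hcomp : Compatible G k u H ι := by
    refine ⟨inferInstance, ?_, ?_, ?_, ?_⟩
    · exact (SimpleGraph.connected_iff_exists_forall_reachable _).2
        ⟨⟨u, huB⟩, fun x => reachable_of_edist_le (hleφ x)⟩
    · intro x hx y hy hxy
      rw [hι x (hball x hx), hι y (hball y hy)] at hxy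
      exact congrArg Subtype.val hxy
    · ext x
      rw [hι u huB]
      constructor
      · intro hx
        have hx : H.edist ⟨u, huB⟩ x ≤ (k : ℕ∞) := hx
        refine ⟨x, ?_, hι x x.2⟩
        obtain ⟨p, hp⟩ := (reachable_of_edist_le hx).exists_walk_length_eq_edist
        refine le_trans ?_ hx
        rw [← hp, ← SimpleGraph.Walk.length_map (SimpleGraph.Embedding.induce B).toHom p]
        exact SimpleGraph.edist_le _
      · rintro ⟨y, hy, rfl⟩
        rw [hι y (hball y hy)]
        exact (hleφ ⟨y, hball y hy⟩).trans ((hφle y).trans hy)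
    · intro x hx y hy
      rw [hι x (hball x hx), hι y (hball y hy)]
      exact hH _ _
  have hwB := hball w hwk
  have := Fintype.ofFinite B
  have key : ∀ (ψ δ ε : V → ℕ), ψ u = 0 → ψ w ≤ 1 →
      (∀ x ∈ B, ∀ y ∈ B, G.Adj x y → ¬ (x = u ∧ y = v) → ¬ (x = v ∧ y = u) → ψ y ≤ ψ x + 1) →
      (∀ x ∈ B, φ x + δ x ≤ ψ x + ε x) → ∑ x : B, ε x ≤ ∑ x : B, δ x → False := by
    intro ψ δ ε h0 h1 h2 h3 h4
    refine absurd (h B H ι hcomp) ?_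
    rw [hι u huB, hι v hvB, hι w hwB]
    refine not_cSum_swap_lt H _ _ _ (fun x => φ x) (fun x => ψ x) hleφ h0 ?_ h1 ?_
    · rintro ⟨x, hx⟩ ⟨y, hy⟩ hxy hn1 hn2
      simp only [Subtype.mk.injEq] at hn1 hn2
      exact h2 x hx y hy hxy hn1 hn2
    · have h5 : ∑ x : B, (φ x + δ x) ≤ ∑ x : B, (ψ x + ε x) :=
        Finset.sum_le_sum fun x _ => h3 x x.2
      rw [Finset.sum_add_distrib, Finset.sum_add_distrib] at h5
      omega
  have hind : ∀ y ∈ B, ∑ x : B, (if (x : V) = y then 1 else 0) = 1 := by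
    intro y hy
    rw [Finset.sum_eq_single (⟨y, hy⟩ : B)] <;> simp +contextual [Subtype.ext_iff]
  have hw' : w = z ∨ w = a ∨ w = b ∨ (G.Adj v w ∧ w ≠ z) := by
    have := (hB w).1 hwB
    tauto
  rcases hw' with rfl | rfl | rfl | ⟨hvw', hwz⟩
  · refine key (fun x => if x = u then 0 else if x = w then 1 else if x = v then 2 else
      if x = a then 2 else if x = b then 2 else 3)
      (fun x => (if x = v then 1 else 0) + (if x = l₁ then 1 else 0) + (if x = l₂ then 1 else 0))
      (fun x => (if x = w then 1 else 0) + (if x = a then 1 else 0) + (if x = b then 1 else 0))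
      (by simp) (by simp [hwu]) ?_ ?_ ?_
    · intro x hx y hy hxy h1 h2
      have hyx := hxy.symm
      rw [hB] at hx hy
      grind
    · intro x hx
      rw [hB] at hx
      simp only [φ]
      grind
    · simp only [Finset.sum_add_distrib, hind _ hvB, hind _ hlB₁, hind _ hlB₂, hind _ hzB,
        hind _ haB, hind _ hbB, le_refl]
  · refine key (fun x => if x = u then 0 else if x = w then 1 else if x = z then 2 else
      if x = v then 3 else if x = b then 3 else 4)
      (fun x => (if x = v then 1 else 0) + (if x = v then 1 else 0))
      (fun x => (if x = w then 1 else 0) + (if x = w then 1 else 0))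
      (by simp) (by simp [hwu]) ?_ ?_ ?_
    · intro x hx y hy hxy h1 h2
      have hyx := hxy.symm
      rw [hB] at hx hy
      grind
    · intro x hx
      rw [hB] at hx
      simp only [φ]
      grind
    · simp only [Finset.sum_add_distrib, hind _ hvB, hind _ haB, le_refl]
  · refine key (fun x => if x = u then 0 else if x = w then 1 else if x = z then 2 else
      if x = v then 3 else if x = a then 3 else 4)
      (fun x => (if x = v then 1 else 0) + (if x = v then 1 else 0))
      (fun x => (if x = w then 1 else 0) + (if x = w then 1 else 0))
      (by simp) (by simp [hwu]) ?_ ?_ ?_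
    · intro x hx y hy hxy h1 h2
      have hyx := hxy.symm
      rw [hB] at hx hy
      grind
    · intro x hx
      rw [hB] at hx
      simp only [φ]
      grind
    · simp only [Finset.sum_add_distrib, hind _ hvB, hind _ hbB, le_refl]
  · refine key (fun x => if x = u then 0 else if x = w then 1 else if x = v then 2 else
      if x = a then 4 else if x = b then 4 else 3)
      (fun x => if x = z then 1 else 0) (fun x => if x = w then 1 else 0)
      (by simp) (by simp [hwu]) ?_ ?_ ?_
    · intro x hx y hy hxy h1 h2
      have hyx := hxy.symm
      rw [hB] at hx hy
      grind
    · intro x hx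
      rw [hB] at hx
      simp only [φ]
      grind
    · simp only [hind _ hzB, hind _ hwB, le_refl]

/-- The graph on `{0, …, n - 1}` in which every vertex `x` is joined to its parent `p x`. -/
def parentGraph (n : ℕ) (p : ℕ → ℕ) : SimpleGraph (Fin n) where
  Adj x y := (x : ℕ) ≠ y ∧ (p x = y ∨ p y = x)
  symm := ⟨fun _ _ h => ⟨h.1.symm, h.2.symm⟩⟩
  loopless := ⟨fun _ h => h.1 rfl⟩

lemma parentGraph_adj {n : ℕ} {p : ℕ → ℕ} {x y : Fin n} :
    (parentGraph n p).Adj x y ↔ (x : ℕ) ≠ y ∧ (p x = y ∨ p y = x) := Iff.rfl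

lemma parentGraph_isTree {n : ℕ} (hn : 0 < n) {p : ℕ → ℕ} (hp0 : p 0 = 0)
    (hp : ∀ x, 0 < x → p x < x) : (parentGraph n p).IsTree := by
  have hconn : (parentGraph n p).Connected := by
    refine (SimpleGraph.connected_iff_exists_forall_reachable _).2 ⟨⟨0, hn⟩, ?_⟩
    rintro ⟨x, hx⟩
    induction x using Nat.strong_induction_on with
    | _ x ih =>
      rcases Nat.eq_zero_or_pos x with rfl | h0
      · exact SimpleGraph.Reachable.refl _
      · have hlt := hp x h0
        refine (ih (p x) hlt (hlt.trans hx)).trans (SimpleGraph.Adj.reachable ?_)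
        exact parentGraph_adj.2 ⟨hlt.ne, Or.inr rfl⟩
  refine SimpleGraph.isTree_iff_connected_and_card.2 ⟨hconn, le_antisymm ?_
    hconn.card_vert_le_card_edgeSet_add_one⟩
  have hple : ∀ x, p x ≤ x := fun x => by
    rcases Nat.eq_zero_or_pos x with rfl | h0
    · exact hp0.le
    · exact (hp x h0).le
  let f : Fin n → Sym2 (Fin n) := fun x => s(x, ⟨p x, (hple x).trans_lt x.2⟩)
  have hsub : (parentGraph n p).edgeSet ⊆ f '' {⟨0, hn⟩}ᶜ := by
    intro z
    induction z using Sym2.ind with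
    | _ x y =>
      rw [SimpleGraph.mem_edgeSet, parentGraph_adj]
      rintro ⟨hne, h | h⟩
      · refine ⟨x, ?_, ?_⟩
        · rintro rfl
          exact hne (by rw [← h]; exact hp0.symm)
        · simp only [f, h]
      · refine ⟨y, ?_, ?_⟩
        · rintro rfl
          exact hne (by rw [← h]; exact hp0)
        · simp only [f, h]
          exact Sym2.eq_swap
  have h1 := Set.ncard_le_ncard hsub (Set.toFinite _)
  have h2 := Set.ncard_image_le (f := f) (Set.toFinite ({⟨0, hn⟩}ᶜ : Set (Fin n)))
  have h3 := Set.ncard_add_ncard_compl ({⟨0, hn⟩} : Set (Fin n))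
  rw [Set.ncard_singleton] at h3
  have h4 : Nat.card (parentGraph n p).edgeSet = (parentGraph n p).edgeSet.ncard := rfl
  omega

/-- Parent function of a caterpillar of stars: the junctions `4, 9, 14, …` form a path from the
star center `0` to the star center `e`, the junction `x < e` also carries the star center `x + 1`,
and every star center `c < e` has the three leaves `c + 1`, `c + 2`, `c + 3`. -/
def combParent (e x : ℕ) : ℕ :=
  if x ≤ 4 then 0 else if e < x then e else if x % 5 = 4 then x - 5 else
    if x % 5 = 0 then x - 1 else x - x % 5

lemma combParent_eq_iff {e x y : ℕ} : combParent e x = y ↔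
    (x ≤ 4 ∧ y = 0) ∨ (4 < x ∧ e < x ∧ y = e) ∨ (4 < x ∧ x ≤ e ∧ x % 5 = 4 ∧ y = x - 5) ∨
      (4 < x ∧ x ≤ e ∧ x % 5 = 0 ∧ y = x - 1) ∨
      (4 < x ∧ x ≤ e ∧ x % 5 ≠ 4 ∧ x % 5 ≠ 0 ∧ y = x - x % 5) := by
  unfold combParent
  split_ifs <;> omega

lemma combTree_adj {n e : ℕ} {x y : Fin n} : (parentGraph n (combParent e)).Adj x y ↔
    (x : ℕ) ≠ y ∧ (combParent e x = y ∨ combParent e y = x) := Iff.rfl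

lemma combTree_isTree {n : ℕ} (hn : 0 < n) (m : ℕ) :
    (parentGraph n (combParent (5 * m + 4))).IsTree := by
  refine parentGraph_isTree hn (by simp [combParent]) fun x hx => ?_
  have := (combParent_eq_iff (e := 5 * m + 4) (x := x)).1 rfl
  omega

lemma not_unhappy_of_three {V : Type} [Fintype V] {G : SimpleGraph V} (hG : G.IsTree)
    {k : ℕ} (hk : k ≤ 3) (u : V) {v w b₁ b₂ b₃ c₁ c₂ c₃ : V} (h₁ : G.Adj v b₁) (h₂ : G.Adj v b₂)
    (h₃ : G.Adj v b₃) (h₁₂ : b₁ ≠ b₂) (h₁₃ : b₁ ≠ b₃) (h₂₃ : b₂ ≠ b₃)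
    (hc₁ : G.Adj b₁ c₁) (hc₂ : G.Adj b₂ c₂) (hc₃ : G.Adj b₃ c₃)
    (hv₁ : c₁ ≠ v) (hv₂ : c₂ ≠ v) (hv₃ : c₃ ≠ v) :
    ¬ UnhappySumVia G k u v w := by
  by_cases hu₁ : b₁ = u
  · exact not_unhappy_of_junction hG hk h₂ h₃ h₂₃ (hu₁ ▸ h₁₂.symm) (hu₁ ▸ h₁₃.symm)
      hc₂ hc₃ hv₂ hv₃
  by_cases hu₂ : b₂ = u
  · exact not_unhappy_of_junction hG hk h₁ h₃ h₁₃ hu₁ (hu₂ ▸ h₂₃.symm) hc₁ hc₃ hv₁ hv₃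
  exact not_unhappy_of_junction hG hk h₁ h₂ h₁₂ hu₁ hu₂ hc₁ hc₂ hv₁ hv₂

lemma parentGraph_not_unhappy_of_star {n : ℕ} {p : ℕ → ℕ} (hT : (parentGraph n p).IsTree) {k : ℕ}
    (hk : k ≤ 3) {v z a b : ℕ} (hv : v + 3 < n) (hz : z < n) (ha : a < n) (hb : b < n)
    (h₁ : p (v + 1) = v) (h₂ : p (v + 2) = v) (h₃ : p (v + 3) = v)
    (hvz : v ≠ z ∧ (p v = z ∨ p z = v)) (hza : z ≠ a ∧ (p z = a ∨ p a = z))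
    (hzb : z ≠ b ∧ (p z = b ∨ p b = z)) (hab : a ≠ b) (hav : a ≠ v) (hbv : b ≠ v)
    (hpab : p a ≠ b) (hpba : p b ≠ a) (hz₁ : z < v ∨ v + 3 < z)
    (hleaf : ∀ x, v ≠ x → (p v = x ∨ p x = v) → x ≠ z → p x = v ∧ ∀ y, p y ≠ x)
    (hnz : ∀ y, z ≠ y → (p z = y ∨ p y = z) → y = v ∨ y = a ∨ y = b)
    {u w : Fin n} (huv : (parentGraph n p).Adj u ⟨v, by omega⟩) :
    ¬ UnhappySumVia (parentGraph n p) k u ⟨v, by omega⟩ w := by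
  have hone : ∀ x : Fin n, (parentGraph n p).Adj ⟨v, by omega⟩ x → x ≠ ⟨z, hz⟩ →
      ∀ y, (parentGraph n p).Adj x y → y = ⟨v, by omega⟩ := by
    intro x hx hxz y hxy
    have := hleaf x hx.1 hx.2 fun h => hxz (Fin.ext h)
    refine Fin.ext ?_
    rcases hxy.2 with h | h
    · exact h.symm.trans this.1
    · exact absurd h (this.2 y)
  have hadj : ∀ i (hi : v + i < n), 0 < i → p (v + i) = v →
      (parentGraph n p).Adj ⟨v, by omega⟩ ⟨v + i, hi⟩ :=
    fun i _ hi h => ⟨by simp only; omega, Or.inr h⟩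
  have hl₁ := hadj 1 (by omega) one_pos h₁
  have hl₂ := hadj 2 (by omega) two_pos h₂
  have hl₃ := hadj 3 (by omega) three_pos h₃
  have hne : ∀ i j (hi : v + i < n) (hj : v + j < n), i ≠ j →
      (⟨v + i, hi⟩ : Fin n) ≠ ⟨v + j, hj⟩ := by
    intro i j _ _ hij h
    rw [Fin.mk.injEq] at h
    omega
  have hnez : ∀ i (hi : v + i < n), i ≤ 3 → (⟨v + i, hi⟩ : Fin n) ≠ ⟨z, hz⟩ := by
    intro i _ hi h
    rw [Fin.mk.injEq] at h
    omega
  by_cases huz : u = ⟨z, hz⟩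
  · subst huz
    refine not_unhappy_of_leaves hT.1 fun x hx hxz => ⟨hone x hx hxz, ?_⟩
    by_cases hx₁ : x = ⟨v + 1, by omega⟩
    · exact ⟨_, hl₂, hnez 2 _ (by omega), hx₁ ▸ hne 2 1 _ _ (by omega)⟩
    · exact ⟨_, hl₁, hnez 1 _ (by omega), fun h => hx₁ h.symm⟩
  have key : ∀ i j (hi : v + i < n) (hj : v + j < n), i ≠ j → i ≤ 3 → j ≤ 3 →
      (parentGraph n p).Adj ⟨v, by omega⟩ ⟨v + i, hi⟩ →
      (parentGraph n p).Adj ⟨v, by omega⟩ ⟨v + j, hj⟩ →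
      ⟨v + i, hi⟩ ≠ u → ⟨v + j, hj⟩ ≠ u →
      ¬ UnhappySumVia (parentGraph n p) k u ⟨v, by omega⟩ w := by
    intro i j hi hj hij hi3 hj3 hai haj hui huj
    refine not_unhappy_of_star_leaf hk huv (z := ⟨z, hz⟩) (a := ⟨a, ha⟩) (b := ⟨b, hb⟩)
      hvz hza hzb ?_ ?_ ?_ ?_ huz hone ?_ hai haj (hne i j hi hj hij) hui huj
      (hnez i hi hi3) (hnez j hj hj3)
    · simpa [Fin.ext_iff] using hab
    · simpa [Fin.ext_iff] using hav
    · simpa [Fin.ext_iff] using hbv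
    · rintro ⟨-, h | h⟩
      · exact hpab h
      · exact hpba h
    · intro y hy
      simpa only [Fin.ext_iff] using hnz y hy.1 hy.2
  by_cases hu₁ : ⟨v + 1, by omega⟩ = u
  · exact key 2 3 _ _ (by omega) (by omega) (by omega) hl₂ hl₃
      (hu₁ ▸ hne 2 1 _ _ (by omega)) (hu₁ ▸ hne 3 1 _ _ (by omega))
  by_cases hu₂ : ⟨v + 2, by omega⟩ = u
  · exact key 1 3 _ _ (by omega) (by omega) (by omega) hl₁ hl₃
      hu₁ (hu₂ ▸ hne 3 2 _ _ (by omega))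
  exact key 1 2 _ _ (by omega) (by omega) (by omega) hl₁ hl₂ hu₁ hu₂

set_option maxHeartbeats 4000000 in
lemma combTree_equilibrium {n m k : ℕ} (hm : 1 ≤ m) (hn : 5 * m + 8 ≤ n) (hk : k ≤ 3) :
    SumEquilibrium (parentGraph n (combParent (5 * m + 4))) k := by
  have hT := combTree_isTree (n := n) (by omega) m
  have hadj : ∀ x y (hx : x < n) (hy : y < n), y < x → combParent (5 * m + 4) x = y →
      (parentGraph n (combParent (5 * m + 4))).Adj ⟨x, hx⟩ ⟨y, hy⟩ :=
    fun x y _ _ hxy h => combTree_adj.2 ⟨hxy.ne', Or.inl h⟩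
  rintro ⟨u, hu⟩ ⟨⟨v, hv⟩, w, hw⟩
  have huv := hw.1.1
  revert hw
  by_cases hleaf : 5 * m + 4 < v ∨ (v % 5 ≠ 0 ∧ v % 5 ≠ 4)
  · refine not_unhappy_of_leaves hT.1 fun x hx hxu => ?_
    rw [combTree_adj, combParent_eq_iff, combParent_eq_iff] at hx huv
    rw [Ne, Fin.ext_iff] at hxu
    simp only at hx hxu huv
    omega
  by_cases hjun : v % 5 = 4 ∧ v < 5 * m + 4
  · have h1 : v = 4 ∨ ∃ r, r + 1 < m ∧ v = 5 * r + 9 := by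
      by_cases h4 : v = 4
      · exact Or.inl h4
      · exact Or.inr ⟨(v - 9) / 5, by omega, by omega⟩
    rcases h1 with rfl | ⟨r, hr, rfl⟩
    · refine not_unhappy_of_three hT hk _
        (hadj 4 0 hv (by omega) ?_ ?_) (hadj 5 4 (by omega) hv ?_ ?_).symm
        (hadj 9 4 (by omega) hv ?_ ?_).symm ?_ ?_ ?_ (hadj 1 0 (by omega) (by omega) ?_ ?_).symm
        (hadj 6 5 (by omega) (by omega) ?_ ?_).symm (hadj 10 9 (by omega) (by omega) ?_ ?_).symm
        ?_ ?_ ?_ <;>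
      first | rw [Ne, Fin.mk.injEq]; omega | rw [combParent_eq_iff]; omega | omega
    · refine not_unhappy_of_three hT hk _
        (hadj _ (5 * r + 4) hv (by omega) ?_ ?_) (hadj (5 * r + 10) _ (by omega) hv ?_ ?_).symm
        (hadj (5 * r + 14) _ (by omega) hv ?_ ?_).symm ?_ ?_ ?_
        (hadj (5 * r + 5) _ (by omega) (by omega) ?_ ?_).symm
        (hadj (5 * r + 11) _ (by omega) (by omega) ?_ ?_).symm
        (hadj (5 * r + 15) _ (by omega) (by omega) ?_ ?_).symm
        ?_ ?_ ?_ <;>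
      first | rw [Ne, Fin.mk.injEq]; omega | rw [combParent_eq_iff]; omega | omega
  have hcase : v = 0 ∨ (∃ r, m = r + 2 ∧ v = 5 * r + 14) ∨ (m = 1 ∧ v = 9) ∨ v = 5 ∨
      ∃ q, v = 5 * q + 10 ∧ q + 2 ≤ m := by
    by_cases he : v = 5 * m + 4
    · by_cases h1 : m = 1
      · omega
      · exact Or.inr (Or.inl ⟨m - 2, by omega, by omega⟩)
    · by_cases h0 : v = 0 ∨ v = 5
      · omega
      · exact Or.inr (Or.inr (Or.inr (Or.inr ⟨(v - 10) / 5, by omega, by omega⟩)))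
  clear hadj
  rcases hcase with rfl | ⟨r, rfl, rfl⟩ | ⟨rfl, rfl⟩ | rfl | ⟨q, rfl, hq⟩
  · refine parentGraph_not_unhappy_of_star hT hk (z := 4) (a := 5) (b := 9)
      ?_ ?_ ?_ ?_ ?_ ?_ ?_ ⟨?_, Or.inr ?_⟩ ⟨?_, Or.inr ?_⟩ ⟨?_, Or.inr ?_⟩
      ?_ ?_ ?_ ?_ ?_ ?_ (fun x hx h hxz => ⟨?_, ?_⟩) (fun y hy h => ?_) huv <;> clear huv hT
    all_goals first
      | omega
      | rw [combParent_eq_iff]; omega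
      | rw [Ne, combParent_eq_iff]; omega
      | rw [combParent_eq_iff, combParent_eq_iff] at h; omega
      | rw [combParent_eq_iff, combParent_eq_iff] at h; rw [combParent_eq_iff]; omega
      | rw [combParent_eq_iff, combParent_eq_iff] at h
        intro y hy
        rw [combParent_eq_iff] at hy
        omega
  · refine parentGraph_not_unhappy_of_star hT hk (z := 5 * r + 9) (a := 5 * r + 10) (b := 5 * r + 4)
      ?_ ?_ ?_ ?_ ?_ ?_ ?_ ⟨?_, Or.inl ?_⟩ ⟨?_, Or.inr ?_⟩ ⟨?_, Or.inl ?_⟩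
      ?_ ?_ ?_ ?_ ?_ ?_ (fun x hx h hxz => ⟨?_, ?_⟩) (fun y hy h => ?_) huv <;> clear huv hT
    all_goals first
      | omega
      | rw [combParent_eq_iff]; omega
      | rw [Ne, combParent_eq_iff]; omega
      | rw [combParent_eq_iff, combParent_eq_iff] at h; omega
      | rw [combParent_eq_iff, combParent_eq_iff] at h; rw [combParent_eq_iff]; omega
      | rw [combParent_eq_iff, combParent_eq_iff] at h
        intro y hy
        rw [combParent_eq_iff] at hy
        omega
  · refine parentGraph_not_unhappy_of_star hT hk (z := 4) (a := 5) (b := 0)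
      ?_ ?_ ?_ ?_ ?_ ?_ ?_ ⟨?_, Or.inl ?_⟩ ⟨?_, Or.inr ?_⟩ ⟨?_, Or.inl ?_⟩
      ?_ ?_ ?_ ?_ ?_ ?_ (fun x hx h hxz => ⟨?_, ?_⟩) (fun y hy h => ?_) huv <;> clear huv hT
    all_goals first
      | omega
      | rw [combParent_eq_iff]; omega
      | rw [Ne, combParent_eq_iff]; omega
      | rw [combParent_eq_iff, combParent_eq_iff] at h; omega
      | rw [combParent_eq_iff, combParent_eq_iff] at h; rw [combParent_eq_iff]; omega
      | rw [combParent_eq_iff, combParent_eq_iff] at h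
        intro y hy
        rw [combParent_eq_iff] at hy
        omega
  · refine parentGraph_not_unhappy_of_star hT hk (z := 4) (a := 9) (b := 0)
      ?_ ?_ ?_ ?_ ?_ ?_ ?_ ⟨?_, Or.inl ?_⟩ ⟨?_, Or.inr ?_⟩ ⟨?_, Or.inl ?_⟩
      ?_ ?_ ?_ ?_ ?_ ?_ (fun x hx h hxz => ⟨?_, ?_⟩) (fun y hy h => ?_) huv <;> clear huv hT
    all_goals first
      | omega
      | rw [combParent_eq_iff]; omega
      | rw [Ne, combParent_eq_iff]; omega
      | rw [combParent_eq_iff, combParent_eq_iff] at h; omega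
      | rw [combParent_eq_iff, combParent_eq_iff] at h; rw [combParent_eq_iff]; omega
      | rw [combParent_eq_iff, combParent_eq_iff] at h
        intro y hy
        rw [combParent_eq_iff] at hy
        omega
  · refine parentGraph_not_unhappy_of_star hT hk (z := 5 * q + 9) (a := 5 * q + 14) (b := 5 * q + 4)
      ?_ ?_ ?_ ?_ ?_ ?_ ?_ ⟨?_, Or.inl ?_⟩ ⟨?_, Or.inr ?_⟩ ⟨?_, Or.inl ?_⟩
      ?_ ?_ ?_ ?_ ?_ ?_ (fun x hx h hxz => ⟨?_, ?_⟩) (fun y hy h => ?_) huv <;> clear huv hT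
    all_goals first
      | omega
      | rw [combParent_eq_iff]; omega
      | rw [Ne, combParent_eq_iff]; omega
      | rw [combParent_eq_iff, combParent_eq_iff] at h; omega
      | rw [combParent_eq_iff, combParent_eq_iff] at h; rw [combParent_eq_iff]; omega
      | rw [combParent_eq_iff, combParent_eq_iff] at h
        intro y hy
        rw [combParent_eq_iff] at hy
        omega

lemma combTree_le_add_dist {n m : ℕ} (hn : 0 < n) (hm : n ≤ 5 * m + 12) (x y : Fin n) :
    (y : ℕ) ≤ x + 13 * (parentGraph n (combParent (5 * m + 4))).dist x y := by
  have hT := (combTree_isTree hn m).1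
  have hlip : ∀ z : Fin n, min ((z + 1 : ℕ) / 5) (m + 1) ≤ min ((x + 1 : ℕ) / 5) (m + 1) +
      (parentGraph n (combParent (5 * m + 4))).dist x z := by
    intro z
    obtain ⟨p, hp⟩ := hT.exists_walk_length_eq_dist x z
    rw [← hp]
    clear hp
    induction p with
    | nil => omega
    | cons h q ih =>
      rw [combTree_adj, combParent_eq_iff, combParent_eq_iff] at h
      rw [SimpleGraph.Walk.length_cons]
      have := h.2
      omega
  have h1 := hlip y
  by_cases hxy : x = y
  · subst hxy
    omega
  · have := hT.pos_dist_of_ne hxy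
    have := x.2
    have := y.2
    omega

lemma six_mul_sum_range_sub (n : ℕ) :
    6 * ∑ x ∈ Finset.range n, ∑ y ∈ Finset.range n, (y - x) + n = n ^ 3 := by
  have h2 : ∀ n : ℕ, 2 * ∑ x ∈ Finset.range n, (n - x) = n * (n + 1) := by
    intro n
    induction n with
    | zero => simp
    | succ n ih =>
      rw [Finset.sum_range_succ', mul_add]
      simp only [Nat.add_sub_add_right, ih]
      rw [Nat.sub_zero]
      ring
  induction n with
  | zero => simp
  | succ n ih =>
    have h3 : ∑ y ∈ Finset.range (n + 1), (y - n) = 0 :=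
      Finset.sum_eq_zero fun y hy => by
        have := Finset.mem_range.1 hy
        omega
    rw [Finset.sum_range_succ, h3]
    simp only [Finset.sum_range_succ, Finset.sum_add_distrib]
    have := h2 n
    nlinarith

lemma pow_three_le_scSum_combTree {n m : ℕ} (hn : 0 < n) (hm : n ≤ 5 * m + 12) :
    n ^ 3 ≤ 78 * scSum (parentGraph n (combParent (5 * m + 4))) + n := by
  have h : ∑ x : Fin n, ∑ y : Fin n, ((y : ℕ) - x) ≤
      13 * scSum (parentGraph n (combParent (5 * m + 4))) := by
    unfold scSum
    simp only [Finset.mul_sum]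
    refine Finset.sum_le_sum fun x _ => Finset.sum_le_sum fun y _ => ?_
    have := combTree_le_add_dist hn hm x y
    omega
  have h' : ∑ x : Fin n, ∑ y : Fin n, ((y : ℕ) - x) =
      ∑ x ∈ Finset.range n, ∑ y ∈ Finset.range n, (y - x) := by
    rw [← Fin.sum_univ_eq_sum_range (fun x => ∑ y ∈ Finset.range n, (y - x))]
    exact Finset.sum_congr rfl fun x _ => Fin.sum_univ_eq_sum_range (fun y => y - (x : ℕ)) n
  have := six_mul_sum_range_sub n
  omega

lemma starTree_isTree {n : ℕ} (hn : 0 < n) : (parentGraph n fun _ => 0).IsTree :=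
  parentGraph_isTree hn rfl fun _ h => h

lemma scSum_starTree_le {n : ℕ} (hn : 0 < n) : scSum (parentGraph n fun _ => 0) ≤ 2 * n ^ 2 := by
  have h1 : ∀ x : Fin n, (parentGraph n fun _ => 0).dist x ⟨0, hn⟩ ≤ 1 := by
    intro x
    by_cases hx : (x : ℕ) = 0
    · rw [show x = ⟨0, hn⟩ from Fin.ext hx, SimpleGraph.dist_self]
      exact zero_le_one
    · exact (SimpleGraph.dist_eq_one_iff_adj.2 (parentGraph_adj.2 ⟨hx, Or.inl rfl⟩)).le
  calc scSum (parentGraph n fun _ => 0) ≤ ∑ _x : Fin n, ∑ _y : Fin n, 2 := by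
        refine Finset.sum_le_sum fun x _ => Finset.sum_le_sum fun y _ => ?_
        refine ((starTree_isTree hn).1.dist_triangle (v := ⟨0, hn⟩)).trans ?_
        exact Nat.add_le_add (h1 x) (SimpleGraph.dist_comm.trans_le (h1 y))
    _ = 2 * n ^ 2 := by simp; ring

lemma scSum_le_pow_three {n : ℕ} {T : SimpleGraph (Fin n)} (hT : T.Connected) :
    scSum T ≤ n ^ 3 := by
  calc scSum T ≤ ∑ _x : Fin n, ∑ _y : Fin n, n := by
        refine Finset.sum_le_sum fun x _ => Finset.sum_le_sum fun y _ => ?_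
        obtain ⟨p, hp, hl⟩ := hT.exists_path_of_dist x y
        rw [← hl]
        simpa using hp.length_lt.le
    _ = n ^ 3 := by simp; ring

lemma sq_le_scSum_add {n : ℕ} {T : SimpleGraph (Fin n)} (hT : T.Connected) :
    n ^ 2 ≤ scSum T + n := by
  calc n ^ 2 = ∑ _x : Fin n, ∑ _y : Fin n, 1 := by simp; ring
    _ ≤ ∑ x : Fin n, ∑ y : Fin n, (T.dist x y + if x = y then 1 else 0) := by
        refine Finset.sum_le_sum fun x _ => Finset.sum_le_sum fun y _ => ?_
        split_ifs with h
        · exact Nat.le_add_left _ _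
        · exact hT.pos_dist_of_ne h
    _ = scSum T + n := by simp [scSum, Finset.sum_add_distrib]

theorem stmt7 : ∃ c₁ c₂ : ℚ, 0 < c₁ ∧ 0 < c₂ ∧
    ∀ n : ℕ, 13 ≤ n → ∀ k : ℕ, (k = 1 ∨ k = 2 ∨ k = 3) →
      c₁ * n ≤ PoA n (fun T => SumEquilibrium T k) scSum ∧
      PoA n (fun T => SumEquilibrium T k) scSum ≤ c₂ * n := by
  refine ⟨1 / 200, 2, by norm_num, by norm_num, fun n hn k hk => ?_⟩
  obtain ⟨m, hm, hmn, hnm⟩ : ∃ m, 1 ≤ m ∧ 5 * m + 8 ≤ n ∧ n ≤ 5 * m + 12 :=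
    ⟨(n - 8) / 5, by omega, by omega, by omega⟩
  have hcomb := combTree_equilibrium (k := k) hm hmn (by omega)
  have hcost := pow_three_le_scSum_combTree (by omega) hnm
  have hT := combTree_isTree (n := n) (by omega) m
  unfold PoA
  set S := {c : ℕ | ∃ T : SimpleGraph (Fin n), T.IsTree ∧ SumEquilibrium T k ∧ scSum T = c}
  set R := {c : ℕ | ∃ T : SimpleGraph (Fin n), T.IsTree ∧ scSum T = c}
  have hmem : scSum (parentGraph n (combParent (5 * m + 4))) ∈ S := ⟨_, hT, hcomb, rfl⟩
  have hub : ∀ c ∈ S, c ≤ n ^ 3 := by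
    rintro _ ⟨T, hT, -, rfl⟩
    exact scSum_le_pow_three hT.1
  have hN₁ : sSup S ≤ n ^ 3 := csSup_le ⟨_, hmem⟩ hub
  have hN₂ : n ^ 3 ≤ 78 * sSup S + n := by
    have := le_csSup ⟨_, hub⟩ hmem
    omega
  have hstar : scSum (parentGraph n fun _ => 0) ∈ R := ⟨_, starTree_isTree (by omega), rfl⟩
  have hD₁ : sInf R ≤ 2 * n ^ 2 := (Nat.sInf_le hstar).trans (scSum_starTree_le (by omega))
  have hD₂ : n ^ 2 ≤ sInf R + n := by
    obtain ⟨T, hT, h⟩ : sInf R ∈ R := Nat.sInf_mem ⟨_, hstar⟩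
    rw [← h]
    exact sq_le_scSum_add hT.1
  generalize sSup S = N at hN₁ hN₂ ⊢
  generalize sInf R = D at hD₁ hD₂ ⊢
  have hN₁ : (N : ℚ) ≤ n ^ 3 := mod_cast hN₁
  have hN₂ : (n : ℚ) ^ 3 ≤ 78 * N + n := mod_cast hN₂
  have hD₁ : (D : ℚ) ≤ 2 * n ^ 2 := mod_cast hD₁
  have hD₂ : (n : ℚ) ^ 2 ≤ D + n := mod_cast hD₂
  have hn' : (13 : ℚ) ≤ n := mod_cast hn
  have hD : (0 : ℚ) < D := by nlinarith
  have h13 : (13 : ℚ) * n ≤ n ^ 2 := by nlinarith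
  have h169 : (13 : ℚ) * n ^ 2 ≤ n ^ 3 := by nlinarith [sq_nonneg (n : ℚ)]
  have hnD : (n : ℚ) * D ≤ n * (2 * n ^ 2) := by gcongr
  have hnD' : (n : ℚ) * n ^ 2 ≤ n * (D + n) := by gcongr
  rw [le_div_iff₀ hD, div_le_iff₀ hD]
  constructor <;> nlinarith

end SwapGame
end

section
/- For every k ≥ 4 and every n ≥ 2, every n-vertex tree that is a sum-swap equilibrium for pessimistic players with k-local information has diameter at most two (i.e., it is a star), and PoA_SUM(n, n−1, k) = 1. -/
open SimpleGraph

namespace SwapGame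

lemma exists_adj_dist_add_one {W : Type} {H : SimpleGraph W} (hH : H.Connected) {a x : W}
    (h : a ≠ x) : ∃ b, H.Adj a b ∧ H.dist b x + 1 = H.dist a x := by
  obtain ⟨p, hp⟩ := hH.exists_walk_length_eq_dist a x
  cases p with
  | nil => exact absurd rfl h
  | @cons _ b _ hab q =>
    refine ⟨b, hab, le_antisymm ?_ ?_⟩
    · rw [← hp, Walk.length_cons]
      exact Nat.add_le_add_right (dist_le q) 1
    · have h1 := hH.dist_triangle (u := a) (v := b) (w := x)
      rw [dist_eq_one_iff_adj.mpr hab] at h1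
      omega

lemma swapGraph_adj_s9 {W : Type} {H : SimpleGraph W} {u v w a b : W} :
    (swapGraph H u v w).Adj a b ↔
      (H.Adj a b ∧ s(a, b) ≠ s(u, v) ∨ s(a, b) = s(u, w)) ∧ a ≠ b := by
  simp only [swapGraph, fromEdgeSet_adj, Set.mem_union, Set.mem_sdiff, mem_edgeSet,
    Set.mem_singleton_iff, ne_eq]

lemma swapGraph_adj_of_ne {W : Type} {H : SimpleGraph W} {u v w a b : W} (h : H.Adj a b)
    (ha : a ≠ u) (hb : b ≠ u) : (swapGraph H u v w).Adj a b := by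
  refine swapGraph_adj_s9.mpr ⟨Or.inl ⟨h, fun h' => ?_⟩, h.ne⟩
  rcases Sym2.eq_iff.mp h' with ⟨h1, -⟩ | ⟨-, h1⟩
  · exact ha h1
  · exact hb h1

lemma swapGraph_adj_of_ne_removed {W : Type} {H : SimpleGraph W} {u v w b : W} (h : H.Adj u b)
    (hb : b ≠ v) : (swapGraph H u v w).Adj u b := by
  refine swapGraph_adj_s9.mpr ⟨Or.inl ⟨h, fun h' => ?_⟩, h.ne⟩
  rcases Sym2.eq_iff.mp h' with ⟨-, h1⟩ | ⟨h2, h1⟩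
  · exact hb h1
  · exact h.ne h1.symm

lemma swapGraph_adj_added {W : Type} {H : SimpleGraph W} {u v w : W} (h : w ≠ u) :
    (swapGraph H u v w).Adj u w :=
  swapGraph_adj_s9.mpr ⟨Or.inr rfl, h.symm⟩

lemma edist_le_of_adj {W : Type} {H : SimpleGraph W} {a b x : W} {m : ℕ} (h : H.Adj a b)
    (hm : H.edist b x ≤ m) : H.edist a x ≤ (m + 1 : ℕ) := by
  refine (SimpleGraph.edist_triangle (v := b)).trans ?_
  rw [edist_eq_one_iff_adj.mpr h, add_comm]
  push_cast
  gcongr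

/-- A geodesic to `x` starting closer to `x` than `u` avoids `u`, hence survives a swap at `u`. -/
lemma edist_swapGraph_le_of_dist_lt {W : Type} {H : SimpleGraph W} (hH : H.Connected)
    {u v w a x : W} (h : H.dist a x < H.dist u x) :
    (swapGraph H u v w).edist a x ≤ H.dist a x := by
  induction hm : H.dist a x generalizing a with
  | zero =>
    rw [hH.dist_eq_zero_iff] at hm
    simp [hm]
  | succ m ih =>
    have hax : a ≠ x := by
      rintro rfl
      simp at hm
    obtain ⟨b, hab, hb⟩ := exists_adj_dist_add_one hH hax
    have hadj : (swapGraph H u v w).Adj a b := by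
      refine swapGraph_adj_of_ne hab ?_ ?_
      · rintro rfl
        omega
      · rintro rfl
        omega
    exact edist_le_of_adj hadj (ih (a := b) (by omega) (by omega))

/-- A swap replacing the path edge `u - v` by `u - w` pays off when the vertices of `A`, which lose
at most one, are fewer than the vertices of `B`, which gain at least one. -/
lemma cSum_swapGraph_lt {W : Type} [Finite W] {H : SimpleGraph W} (hH : H.Connected) {u v w : W}
    (huv : H.Adj u v) (hvw : H.Adj v w) (hwu : w ≠ u) (A B : Finset W) (hAB : A.card < B.card)
    (hB : ∀ x ∈ B, H.dist w x + 2 ≤ H.dist u x)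
    (hA : ∀ x, x = u ∨ H.dist w x + 2 ≤ H.dist u x ∨
      (∃ y, H.Adj u y ∧ y ≠ v ∧ H.dist y x + 1 = H.dist u x) ∨ x ∈ A) :
    cSum (swapGraph H u v w) u < cSum H u := by
  classical
  have := Fintype.ofFinite W
  have hgain : ∀ x, H.dist w x + 2 ≤ H.dist u x →
      (swapGraph H u v w).edist u x + 1 ≤ H.dist u x := by
    intro x hx
    have h1 := edist_swapGraph_le_of_dist_lt hH (u := u) (v := v) (w := w) (a := w) (x := x)
      (by omega)
    have h2 := edist_le_of_adj (swapGraph_adj_added (H := H) (v := v) hwu) h1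
    calc _ ≤ ((H.dist w x + 1 : ℕ) : ℕ∞) + 1 := by gcongr
      _ ≤ _ := by exact_mod_cast hx
  have hsame : ∀ x y, H.Adj u y → y ≠ v → H.dist y x + 1 = H.dist u x →
      (swapGraph H u v w).edist u x ≤ H.dist u x := by
    intro x y huy hyv hyx
    have h1 := edist_swapGraph_le_of_dist_lt hH (u := u) (v := v) (w := w) (a := y) (x := x)
      (by omega)
    rw [← hyx]
    exact edist_le_of_adj (swapGraph_adj_of_ne_removed huy hyv) h1
  have hloss : ∀ x, (swapGraph H u v w).edist u x ≤ H.dist u x + 1 := by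
    intro x
    rcases eq_or_ne u x with rfl | hux
    · simp
    obtain ⟨y, huy, hyx⟩ := exists_adj_dist_add_one hH hux
    rcases eq_or_ne y v with rfl | hyv
    · have h1 := edist_swapGraph_le_of_dist_lt hH (u := u) (v := y) (w := w) (a := y) (x := x)
        (by omega)
      have h2 := edist_le_of_adj (swapGraph_adj_of_ne (u := u) (v := y) (w := w) hvw.symm hwu
        huv.ne') h1
      have h3 := edist_le_of_adj (swapGraph_adj_added (H := H) (v := y) hwu) h2
      rw [← hyx]
      exact_mod_cast h3
    · exact (hsame x y huy hyv hyx).trans le_self_add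
  have hpt : ∀ x, (swapGraph H u v w).edist u x + (if x ∈ B then 1 else 0) ≤
      H.edist u x + (if x ∈ A then 1 else 0) := by
    intro x
    rw [← (hH u x).coe_dist_eq_edist]
    by_cases hxB : x ∈ B
    · simp only [hxB, if_true]
      exact (hgain x (hB x hxB)).trans le_self_add
    · simp only [hxB, if_false, add_zero]
      rcases hA x with rfl | h | ⟨y, h1, h2, h3⟩ | h
      · simp
      · exact le_self_add.trans ((hgain x h).trans le_self_add)
      · exact (hsame x y h1 h2 h3).trans le_self_add
      · simpa [h] using hloss x
  have hsum := Finset.sum_le_sum fun x (_ : x ∈ Finset.univ) => hpt x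
  simp only [Finset.sum_add_distrib, Finset.sum_ite_mem, Finset.univ_inter, Finset.sum_const,
    nsmul_eq_mul, mul_one] at hsum
  have hfin : ∑ x, H.edist u x = ((∑ x, H.dist u x : ℕ) : ℕ∞) := by
    push_cast
    exact Finset.sum_congr rfl fun x _ => ((hH u x).coe_dist_eq_edist).symm
  simp only [cSum, tsum_fintype]
  rw [hfin] at hsum ⊢
  generalize ∑ x, (swapGraph H u v w).edist u x = S at hsum ⊢
  induction S using ENat.recTopCoe with
  | top => simp at hsum
  | coe m =>
    have : m + B.card ≤ ∑ x, H.dist u x + A.card := by exact_mod_cast hsum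
    exact_mod_cast (by omega : m < ∑ x, H.dist u x)

section Compatible

variable {V W : Type} {T : SimpleGraph V} {k : ℕ} {u : V} {H : SimpleGraph W} {ι : V → W}

lemma mem_ball_iff_dist_le (hT : T.Connected) {a : V} : a ∈ ball T u k ↔ T.dist u a ≤ k := by
  rw [ball, Set.mem_ofPred_eq, ← (hT u a).coe_dist_eq_edist, Nat.cast_le]

lemma Compatible.adj_iff (hT : T.Connected) (h : Compatible T k u H ι) {a b : V}
    (ha : T.dist u a ≤ k) (hb : T.dist u b ≤ k) : H.Adj (ι a) (ι b) ↔ T.Adj a b :=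
  h.2.2.2.2 a ((mem_ball_iff_dist_le hT).mpr ha) b ((mem_ball_iff_dist_le hT).mpr hb)

lemma Compatible.injective (hT : T.Connected) (h : Compatible T k u H ι) {a b : V}
    (ha : T.dist u a ≤ k) (hb : T.dist u b ≤ k) (hab : ι a = ι b) : a = b :=
  h.2.2.1 ((mem_ball_iff_dist_le hT).mpr ha) ((mem_ball_iff_dist_le hT).mpr hb) hab

lemma Compatible.exists_eq (hT : T.Connected) (h : Compatible T k u H ι) {x : W}
    (hx : H.dist (ι u) x ≤ k) : ∃ a, ι a = x ∧ T.dist u a ≤ k := by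
  have h1 : x ∈ ι '' ball T u k := by
    rw [← h.2.2.2.1, Set.mem_ofPred_eq, ← (h.2.1 (ι u) x).coe_dist_eq_edist]
    exact_mod_cast hx
  obtain ⟨a, ha, rfl⟩ := h1
  exact ⟨a, rfl, (mem_ball_iff_dist_le hT).mp ha⟩

lemma Compatible.dist_le (hT : T.Connected) (h : Compatible T k u H ι) (m : ℕ) (hm : m ≤ k)
    {a : V} (ha : T.dist u a ≤ m) : H.dist (ι u) (ι a) ≤ m := by
  induction m generalizing a with
  | zero =>
    obtain rfl : u = a := by simpa [hT.dist_eq_zero_iff] using ha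
    simp
  | succ m ih =>
    rcases eq_or_ne a u with rfl | hau
    · simp
    obtain ⟨b, hab, hb⟩ := exists_adj_dist_add_one hT hau
    rw [T.dist_comm (u := b), T.dist_comm (u := a)] at hb
    have h1 := ih (by omega) (a := b) (by omega)
    have h2 := (h.adj_iff hT (by omega) (by omega)).mpr hab.symm
    have h3 := h.2.1.dist_triangle (u := ι u) (v := ι b) (w := ι a)
    rw [dist_eq_one_iff_adj.mpr h2] at h3
    omega

lemma Compatible.exists_dist_le (hT : T.Connected) (h : Compatible T k u H ι) (m : ℕ)
    (hm : m ≤ k) {x : W} (hx : H.dist (ι u) x ≤ m) : ∃ a, ι a = x ∧ T.dist u a ≤ m := by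
  induction m generalizing x with
  | zero =>
    refine ⟨u, ?_, by simp⟩
    simpa [h.2.1.dist_eq_zero_iff] using hx
  | succ m ih =>
    rcases eq_or_ne x (ι u) with rfl | hxu
    · exact ⟨u, rfl, by simp⟩
    obtain ⟨y, hxy, hy⟩ := exists_adj_dist_add_one h.2.1 hxu
    rw [H.dist_comm (u := y), H.dist_comm (u := x)] at hy
    obtain ⟨b, rfl, hb⟩ := ih (by omega) (x := y) (by omega)
    obtain ⟨a, rfl, ha⟩ := h.exists_eq hT (x := x) (by omega)
    refine ⟨a, rfl, ?_⟩
    have h2 := (h.adj_iff hT ha (by omega)).mp hxy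
    have h3 := hT.dist_triangle (u := u) (v := b) (w := a)
    rw [dist_eq_one_iff_adj.mpr h2.symm] at h3
    omega

lemma Compatible.dist_eq (hT : T.Connected) (h : Compatible T k u H ι) {a : V}
    (ha : T.dist u a ≤ k) : H.dist (ι u) (ι a) = T.dist u a := by
  have h1 := h.dist_le hT _ ha le_rfl
  refine le_antisymm h1 ?_
  obtain ⟨b, hb, hb'⟩ := h.exists_dist_le hT _ (h1.trans ha) le_rfl
  obtain rfl := h.injective hT (hb'.trans (h1.trans ha)) ha hb
  exact hb'

lemma Compatible.exists_adj (hT : T.Connected) (h : Compatible T k u H ι) {a : V}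
    (ha : T.dist u a < k) {y : W} (hy : H.Adj (ι a) y) : ∃ b, ι b = y ∧ T.Adj a b := by
  have h1 := h.dist_eq hT ha.le
  have h2 := h.2.1.dist_triangle (u := ι u) (v := ι a) (w := y)
  rw [dist_eq_one_iff_adj.mpr hy] at h2
  obtain ⟨b, rfl, hb⟩ := h.exists_eq hT (x := y) (by omega)
  exact ⟨b, rfl, (h.adj_iff hT ha.le hb).mp hy⟩

end Compatible

lemma IsTree.eq_of_adj_of_dist_add_one {V : Type} {T : SimpleGraph V} (hT : T.IsTree)
    {r a b c : V} (hab : T.Adj a b) (hac : T.Adj a c) (hb : T.dist b r + 1 = T.dist a r)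
    (hc : T.dist c r + 1 = T.dist a r) : b = c := by
  obtain ⟨p, hp⟩ := hT.connected.exists_walk_length_eq_dist b r
  obtain ⟨q, hq⟩ := hT.connected.exists_walk_length_eq_dist c r
  have hp' : (Walk.cons hab p).IsPath := Walk.isPath_of_length_eq_dist _ (by simp [hp, hb])
  have hq' : (Walk.cons hac q).IsPath := Walk.isPath_of_length_eq_dist _ (by simp [hq, hc])
  have := (hT.existsUnique_path a r).unique hp' hq'
  simp only [Walk.cons.injEq] at this
  exact this.1

/-- In the tree `T` rooted at `r`, of height `D`, the vertices `x₀, x₁, x₂, x₃` form a path that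
climbs from a deepest vertex `x₀` towards the root. -/
structure IsDeepPath {V : Type} (T : SimpleGraph V) (r : V) (D : ℕ) (x₀ x₁ x₂ x₃ : V) : Prop where
  isTree : T.IsTree
  adj₀ : T.Adj x₀ x₁
  adj₁ : T.Adj x₁ x₂
  adj₂ : T.Adj x₂ x₃
  dist₀ : T.dist x₀ r = D
  dist₁ : T.dist x₁ r + 1 = D
  dist₂ : T.dist x₂ r + 2 = D
  dist₃ : T.dist x₃ r + 3 = D
  dist_le : ∀ z, T.dist z r ≤ D

namespace IsDeepPath

variable {V : Type} {T : SimpleGraph V} {r : V} {D : ℕ} {x₀ x₁ x₂ x₃ : V}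

lemma child (h : IsDeepPath T r D x₀ x₁ x₂ x₃) {a b c : V} (hac : T.Adj a c) (hab : T.Adj a b)
    (hc : T.dist c r + 1 = T.dist a r) (hbc : b ≠ c) : T.dist b r = T.dist a r + 1 := by
  rcases h.isTree.dist_eq_dist_add_one_of_adj r hab with h1 | h1
  · rw [T.dist_comm (u := r), T.dist_comm (u := r)] at h1
    exact absurd (IsTree.eq_of_adj_of_dist_add_one h.isTree hab hac h1.symm hc) hbc
  · rwa [T.dist_comm (u := r), T.dist_comm (u := r)] at h1

lemma leaf (h : IsDeepPath T r D x₀ x₁ x₂ x₃) {a b c : V} (hac : T.Adj a c)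
    (hc : T.dist c r + 1 = T.dist a r) (ha : T.dist a r = D) (hab : T.Adj a b) : b = c := by
  by_contra hbc
  have h1 := h.child hac hab hc hbc
  have h2 := h.dist_le b
  omega

lemma dist_left_child (h : IsDeepPath T r D x₀ x₁ x₂ x₃) {z : V} (hz : T.Adj x₁ z) (hz2 : z ≠ x₂) :
    T.dist z r = D := by
  have h1 := h.child h.adj₁ hz (by have := h.dist₁; have := h.dist₂; omega) hz2
  have := h.dist₁
  omega

lemma dist_child (h : IsDeepPath T r D x₀ x₁ x₂ x₃) {z : V} (hz : T.Adj x₂ z) (hz3 : z ≠ x₃) :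
    T.dist z r + 1 = D := by
  have h1 := h.child h.adj₂ hz (by have := h.dist₂; have := h.dist₃; omega) hz3
  have := h.dist₂
  omega

lemma dist_grandchild (h : IsDeepPath T r D x₀ x₁ x₂ x₃) {c z : V} (hc : T.Adj x₂ c)
    (hc3 : c ≠ x₃) (hz : T.Adj c z) (hz2 : z ≠ x₂) : T.dist z r = D := by
  have h0 := h.dist_child hc hc3
  have h1 := h.child hc.symm hz (by have := h.dist₂; omega) hz2
  omega

lemma leaf_left (h : IsDeepPath T r D x₀ x₁ x₂ x₃) {z q : V} (hz : T.Adj x₁ z) (hz2 : z ≠ x₂)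
    (hq : T.Adj z q) : q = x₁ := by
  have h1 := h.dist_left_child hz hz2
  exact h.leaf hz.symm (by have := h.dist₁; omega) h1 hq

lemma leaf_grandchild (h : IsDeepPath T r D x₀ x₁ x₂ x₃) {c z q : V} (hc : T.Adj x₂ c)
    (hc3 : c ≠ x₃) (hz : T.Adj c z) (hz2 : z ≠ x₂) (hq : T.Adj z q) : q = c := by
  have h0 := h.dist_child hc hc3
  have h1 := h.dist_grandchild hc hc3 hz hz2
  exact h.leaf hz.symm (by omega) h1 hq


section Views

variable {W : Type} {H : SimpleGraph W} {ι : V → W} {k : ℕ}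

lemma view_left (h : IsDeepPath T r D x₀ x₁ x₂ x₃) (hk : 4 ≤ k) (hc : Compatible T k x₀ H ι)
    (x : W) : x = ι x₀ ∨ H.dist (ι x₂) x + 2 = H.dist (ι x₀) x ∨
      ∃ a, ι a = x ∧ (a = x₁ ∨ T.Adj x₁ a ∧ a ≠ x₂ ∧ a ≠ x₀) := by
  have hT := h.isTree.connected
  have h02 : x₀ ≠ x₂ := by
    rintro rfl
    have := h.dist₀
    have := h.dist₂
    omega
  have d1 : T.dist x₀ x₁ = 1 := dist_eq_one_iff_adj.mpr h.adj₀
  rcases eq_or_ne x (ι x₀) with rfl | hx0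
  · exact Or.inl rfl
  obtain ⟨y, hy, hyx⟩ := exists_adj_dist_add_one hc.2.1 hx0.symm
  obtain ⟨b, rfl, hb⟩ := hc.exists_adj hT (by simp; omega) hy
  obtain rfl := h.leaf_left h.adj₀.symm h02 hb
  rcases eq_or_ne x (ι b) with rfl | hx1
  · exact Or.inr (Or.inr ⟨b, rfl, Or.inl rfl⟩)
  obtain ⟨z, hz, hzx⟩ := exists_adj_dist_add_one hc.2.1 hx1.symm
  obtain ⟨c, rfl, hbc⟩ := hc.exists_adj hT (by omega) hz
  rcases eq_or_ne c x₂ with rfl | hc2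
  · exact Or.inr (Or.inl (by omega))
  have hc0 : c ≠ x₀ := by
    rintro rfl
    omega
  refine Or.inr (Or.inr ⟨c, ?_, Or.inr ⟨hbc, hc2, hc0⟩⟩)
  by_contra hcx
  obtain ⟨q, hq, hqx⟩ := exists_adj_dist_add_one hc.2.1 hcx
  have d2 := hT.dist_triangle (u := x₀) (v := b) (w := c)
  rw [dist_eq_one_iff_adj.mpr hbc] at d2
  obtain ⟨e, rfl, he⟩ := hc.exists_adj hT (by omega) hq
  obtain rfl := h.leaf_left hbc hc2 he
  omega

lemma view_right (h : IsDeepPath T r D x₀ x₁ x₂ x₃) (hk : 4 ≤ k) (hc : Compatible T k x₃ H ι)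
    (x : W) : x = ι x₃ ∨ H.dist (ι x₁) x + 2 = H.dist (ι x₃) x ∨
      (∃ y, H.Adj (ι x₃) y ∧ y ≠ ι x₂ ∧ H.dist y x + 1 = H.dist (ι x₃) x) ∨
      ∃ a, ι a = x ∧ (a = x₂ ∨ (T.Adj x₂ a ∧ a ≠ x₁ ∧ a ≠ x₃) ∨
        ∃ c, T.Adj x₂ c ∧ c ≠ x₁ ∧ c ≠ x₃ ∧ T.Adj c a ∧ a ≠ x₂) := by
  have hT := h.isTree.connected
  have d1 : T.dist x₃ x₂ = 1 := dist_eq_one_iff_adj.mpr h.adj₂.symm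
  rcases eq_or_ne x (ι x₃) with rfl | hx0
  · exact Or.inl rfl
  obtain ⟨y, hy, hyx⟩ := exists_adj_dist_add_one hc.2.1 hx0.symm
  by_cases hy2 : y ≠ ι x₂
  · exact Or.inr (Or.inr (Or.inl ⟨y, hy, hy2, hyx⟩))
  obtain rfl := not_not.mp hy2
  rcases eq_or_ne x (ι x₂) with rfl | hx1
  · exact Or.inr (Or.inr (Or.inr ⟨x₂, rfl, Or.inl rfl⟩))
  obtain ⟨z, hz, hzx⟩ := exists_adj_dist_add_one hc.2.1 hx1.symm
  obtain ⟨c, rfl, h2c⟩ := hc.exists_adj hT (by omega) hz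
  rcases eq_or_ne c x₁ with rfl | hc1
  · exact Or.inr (Or.inl (by omega))
  have hc3 : c ≠ x₃ := by
    rintro rfl
    omega
  rcases eq_or_ne x (ι c) with rfl | hxc
  · exact Or.inr (Or.inr (Or.inr ⟨c, rfl, Or.inr (Or.inl ⟨h2c, hc1, hc3⟩)⟩))
  obtain ⟨q, hq, hqx⟩ := exists_adj_dist_add_one hc.2.1 hxc.symm
  have d2 := hT.dist_triangle (u := x₃) (v := x₂) (w := c)
  rw [dist_eq_one_iff_adj.mpr h2c] at d2
  obtain ⟨g, rfl, hcg⟩ := hc.exists_adj hT (by omega) hq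
  have hg2 : g ≠ x₂ := by
    rintro rfl
    omega
  refine Or.inr (Or.inr (Or.inr ⟨g, ?_, Or.inr (Or.inr ⟨c, h2c, hc1, hc3, hcg, hg2⟩)⟩))
  by_contra hgx
  obtain ⟨s, hs, hsx⟩ := exists_adj_dist_add_one hc.2.1 hgx
  have d3 := hT.dist_triangle (u := x₃) (v := c) (w := g)
  rw [dist_eq_one_iff_adj.mpr hcg] at d3
  obtain ⟨e, rfl, he⟩ := hc.exists_adj hT (by omega) hs
  obtain rfl := h.leaf_grandchild h2c hc3 hcg hg2 he
  omega

end Views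

lemma dist_le_add (h : IsDeepPath T r D x₀ x₁ x₂ x₃) (a b : V) :
    T.dist a r ≤ T.dist a b + T.dist b r :=
  h.isTree.connected.dist_triangle

lemma validSwap_left (h : IsDeepPath T r D x₀ x₁ x₂ x₃) {k : ℕ} (hk : 4 ≤ k) :
    ValidSwap T k x₀ x₁ x₂ := by
  have hT := h.isTree.connected
  have d02 := hT.dist_triangle (u := x₀) (v := x₁) (w := x₂)
  rw [dist_eq_one_iff_adj.mpr h.adj₀, dist_eq_one_iff_adj.mpr h.adj₁] at d02
  have e := h.dist_le_add x₀ x₂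
  have := h.dist₀
  have := h.dist₂
  refine ⟨h.adj₀, ?_, fun hadj => ?_, ?_⟩
  · exact (mem_ball_iff_dist_le hT).mpr (by omega)
  · rw [dist_eq_one_iff_adj.mpr hadj] at e
    omega
  · rintro rfl
    omega

lemma validSwap_right (h : IsDeepPath T r D x₀ x₁ x₂ x₃) {k : ℕ} (hk : 4 ≤ k) :
    ValidSwap T k x₃ x₂ x₁ := by
  have hT := h.isTree.connected
  have d31 := hT.dist_triangle (u := x₃) (v := x₂) (w := x₁)
  rw [dist_eq_one_iff_adj.mpr h.adj₂.symm, dist_eq_one_iff_adj.mpr h.adj₁.symm] at d31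
  have e := h.dist_le_add x₁ x₃
  have := h.dist₁
  have := h.dist₃
  refine ⟨h.adj₂.symm, ?_, fun hadj => ?_, ?_⟩
  · exact (mem_ball_iff_dist_le hT).mpr (by omega)
  · rw [dist_eq_one_iff_adj.mpr hadj.symm] at e
    omega
  · rintro rfl
    omega

/-- If the branch of `x₂` is smaller than the star around `x₁`, then `x₃` moves to `x₁`. -/
lemma unhappy_right (h : IsDeepPath T r D x₀ x₁ x₂ x₃) {k : ℕ}
    (hk : 4 ≤ k) {S N : Finset V}
    (hS : ∀ a, a ∈ S ↔ a = x₂ ∨ (T.Adj x₂ a ∧ a ≠ x₁ ∧ a ≠ x₃) ∨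
      ∃ c, T.Adj x₂ c ∧ c ≠ x₁ ∧ c ≠ x₃ ∧ T.Adj c a ∧ a ≠ x₂)
    (hN : ∀ a, a ∈ N ↔ T.Adj x₁ a ∧ a ≠ x₂) (hcard : S.card < N.card + 1) :
    UnhappySumVia T k x₃ x₂ x₁ := by
  classical
  refine ⟨h.validSwap_right hk, fun W H ι hc => ?_⟩
  have := hc.1
  have hT := h.isTree.connected
  have d32 : T.dist x₃ x₂ = 1 := dist_eq_one_iff_adj.mpr h.adj₂.symm
  have d31 := hT.dist_triangle (u := x₃) (v := x₂) (w := x₁)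
  rw [d32, dist_eq_one_iff_adj.mpr h.adj₁.symm] at d31
  have e31 := h.dist_le_add x₁ x₃
  rw [T.dist_comm (u := x₁) (v := x₃)] at e31
  have := h.dist₁
  have := h.dist₃
  have dz : ∀ z ∈ N, T.dist x₃ z = 3 := by
    intro z hz
    rw [hN] at hz
    have h1 := hT.dist_triangle (u := x₃) (v := x₁) (w := z)
    rw [dist_eq_one_iff_adj.mpr hz.1] at h1
    have h2 := h.dist_le_add z x₃
    rw [T.dist_comm (u := z) (v := x₃), h.dist_left_child hz.1 hz.2] at h2
    omega
  have hx1 : x₁ ∉ N := fun hx => T.irrefl ((hN x₁).mp hx).1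
  have hball : ∀ a ∈ insert x₁ N, T.dist x₃ a ≤ k := by
    intro a ha
    rcases Finset.mem_insert.mp ha with rfl | ha
    · omega
    · rw [dz a ha]
      omega
  refine cSum_swapGraph_lt hc.2.1 ((hc.adj_iff hT (by simp) (by omega)).mpr h.adj₂.symm)
    ((hc.adj_iff hT (by omega) (by omega)).mpr h.adj₁.symm) (fun he => ?_)
    (S.image ι) ((insert x₁ N).image ι) ?_ ?_ ?_
  · have := hc.injective hT (by omega) (by simp) he
    subst this
    omega
  · rw [Finset.card_image_of_injOn (s := insert x₁ N)
      fun a ha b hb hab => hc.injective hT (hball a ha) (hball b hb) hab,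
      Finset.card_insert_of_notMem hx1]
    exact Finset.card_image_le.trans_lt hcard
  · intro x hx
    obtain ⟨a, ha, rfl⟩ := Finset.mem_image.mp hx
    rw [hc.dist_eq hT (hball a ha)]
    rcases Finset.mem_insert.mp ha with rfl | ha'
    · rw [SimpleGraph.dist_self]
      omega
    · rw [dz a ha', dist_eq_one_iff_adj.mpr
        ((hc.adj_iff hT (by omega) (hball a ha)).mpr ((hN a).mp ha').1)]
  · intro x
    rcases h.view_right hk hc x with hx | hx | hx | ⟨a, rfl, ha⟩
    · exact Or.inl hx
    · exact Or.inr (Or.inl hx.le)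
    · exact Or.inr (Or.inr (Or.inl hx))
    · exact Or.inr (Or.inr (Or.inr (Finset.mem_image_of_mem ι ((hS a).mpr ha))))

/-- If the star around `x₁` is at most as large as the branch of `x₂`, then `x₀` moves to `x₂`. -/
lemma unhappy_left (h : IsDeepPath T r D x₀ x₁ x₂ x₃) {k : ℕ}
    (hk : 4 ≤ k) {S N : Finset V}
    (hS : ∀ a, a ∈ S ↔ a = x₂ ∨ (T.Adj x₂ a ∧ a ≠ x₁ ∧ a ≠ x₃) ∨
      ∃ c, T.Adj x₂ c ∧ c ≠ x₁ ∧ c ≠ x₃ ∧ T.Adj c a ∧ a ≠ x₂)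
    (hN : ∀ a, a ∈ N ↔ T.Adj x₁ a ∧ a ≠ x₂) (hcard : N.card < S.card + 1) :
    UnhappySumVia T k x₀ x₁ x₂ := by
  classical
  have hvalid := h.validSwap_left hk
  refine ⟨hvalid, fun W H ι hc => ?_⟩
  have := hc.1
  have hT := h.isTree.connected
  have d0 := h.dist₀
  have d1 := h.dist₁
  have d2 := h.dist₂
  have d3 := h.dist₃
  have hx0 : x₀ ∈ N := (hN x₀).mpr ⟨h.adj₀.symm, hvalid.2.2.2.symm⟩
  have d02 : T.dist x₀ x₂ ≤ 2 := by
    have h1 := hT.dist_triangle (u := x₀) (v := x₁) (w := x₂)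
    rwa [dist_eq_one_iff_adj.mpr h.adj₀, dist_eq_one_iff_adj.mpr h.adj₁] at h1
  have d01 : T.dist x₀ x₁ = 1 := dist_eq_one_iff_adj.mpr h.adj₀
  have d2adj : ∀ c, T.Adj x₂ c → T.dist x₀ c ≤ 3 := by
    intro c hc
    have h1 := hT.dist_triangle (u := x₀) (v := x₂) (w := c)
    rw [dist_eq_one_iff_adj.mpr hc] at h1
    omega
  have hball : ∀ a ∈ insert x₃ S, T.dist x₀ a ≤ k := by
    intro a ha
    rcases Finset.mem_insert.mp ha with rfl | ha
    · exact (d2adj a h.adj₂).trans (by omega)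
    · rcases (hS a).mp ha with rfl | ⟨ha, -⟩ | ⟨c, hc, -, -, hca, -⟩
      · omega
      · exact (d2adj a ha).trans (by omega)
      · have h1 := hT.dist_triangle (u := x₀) (v := c) (w := a)
        rw [dist_eq_one_iff_adj.mpr hca] at h1
        have := d2adj c hc
        omega
  have hx3 : x₃ ∉ S := by
    intro hx
    rcases (hS x₃).mp hx with h1 | ⟨-, -, h1⟩ | ⟨c, hc, -, hc3, hca, h2⟩
    · exact h.adj₂.ne h1.symm
    · exact h1 rfl
    · have := h.dist_grandchild hc hc3 hca h2
      omega
  have hdisj : ∀ a ∈ insert x₃ S, a ≠ x₁ ∧ a ∉ N := by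
    intro a ha
    rw [hN]
    have hNa : T.Adj x₁ a ∧ a ≠ x₂ → T.dist a r = D := fun h' => h.dist_left_child h'.1 h'.2
    rcases Finset.mem_insert.mp ha with rfl | ha
    · refine ⟨?_, fun h' => ?_⟩
      · rintro rfl
        omega
      · have := hNa h'
        omega
    rcases (hS a).mp ha with rfl | ⟨h1, h2, h3⟩ | ⟨c, hc, hc1, hc3, hca, h2⟩
    · exact ⟨h.adj₁.ne', fun h' => h'.2 rfl⟩
    · refine ⟨h2, fun h' => ?_⟩
      have := hNa h'
      have := h.dist_child h1 h3
      omega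
    · refine ⟨?_, fun h' => ?_⟩
      · rintro rfl
        have := h.dist_grandchild hc hc3 hca h2
        omega
      · exact hc1 (h.leaf_left h'.1 h'.2 hca.symm)
  refine cSum_swapGraph_lt hc.2.1 ((hc.adj_iff hT (by simp) (by omega)).mpr h.adj₀)
    ((hc.adj_iff hT (by omega) (by omega)).mpr h.adj₁) (fun he => ?_)
    ((insert x₁ (N.erase x₀)).image ι) ((insert x₃ S).image ι) ?_ ?_ ?_
  · exact hvalid.2.2.2 (hc.injective hT (by omega) (by simp) he)
  · rw [Finset.card_image_of_injOn (s := insert x₃ S)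
      fun a ha b hb hab => hc.injective hT (hball a ha) (hball b hb) hab,
      Finset.card_insert_of_notMem hx3]
    refine (Finset.card_image_le.trans (Finset.card_insert_le _ _)).trans_lt ?_
    rw [Finset.card_erase_add_one hx0]
    exact hcard
  · intro x hx
    obtain ⟨a, ha, rfl⟩ := Finset.mem_image.mp hx
    obtain ⟨ha1, haN⟩ := hdisj a ha
    rcases h.view_left hk hc (ι a) with hx | hx | ⟨b, hba, hb⟩
    · have := hc.injective hT (hball a ha) (by simp) hx
      subst this
      exact absurd hx0 haN
    · exact hx.le
    · have hbk : T.dist x₀ b ≤ k := by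
        rcases hb with rfl | ⟨hb, -⟩
        · omega
        · have h1 := hT.dist_triangle (u := x₀) (v := x₁) (w := b)
          rw [dist_eq_one_iff_adj.mpr hb] at h1
          omega
      have := hc.injective hT hbk (hball a ha) hba
      subst this
      rcases hb with hb | ⟨hb, hb2, -⟩
      · exact absurd hb ha1
      · exact absurd ((hN b).mpr ⟨hb, hb2⟩) haN
  · intro x
    rcases h.view_left hk hc x with hx | hx | ⟨a, rfl, ha⟩
    · exact Or.inl hx
    · exact Or.inr (Or.inl hx.le)
    · refine Or.inr (Or.inr (Or.inr (Finset.mem_image_of_mem ι ?_)))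
      rcases ha with rfl | ⟨h1, h2, h3⟩
      · exact Finset.mem_insert_self _ _
      · exact Finset.mem_insert_of_mem (Finset.mem_erase.mpr ⟨h3, (hN a).mpr ⟨h1, h2⟩⟩)

lemma not_sumEquilibrium [Finite V] (h : IsDeepPath T r D x₀ x₁ x₂ x₃) {k : ℕ} (hk : 4 ≤ k) :
    ¬ SumEquilibrium T k := by
  classical
  have := Fintype.ofFinite V
  intro heq
  let S : Finset V := {a | a = x₂ ∨ (T.Adj x₂ a ∧ a ≠ x₁ ∧ a ≠ x₃) ∨
    ∃ c, T.Adj x₂ c ∧ c ≠ x₁ ∧ c ≠ x₃ ∧ T.Adj c a ∧ a ≠ x₂}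
  let N : Finset V := {a | T.Adj x₁ a ∧ a ≠ x₂}
  have hS : ∀ a, a ∈ S ↔ _ := fun a => Finset.mem_filter_univ a
  have hN : ∀ a, a ∈ N ↔ _ := fun a => Finset.mem_filter_univ a
  rcases lt_or_ge S.card (N.card + 1) with hlt | hge
  · exact heq x₃ ⟨x₂, x₁, h.unhappy_right hk hS hN hlt⟩
  · exact heq x₀ ⟨x₁, x₂, h.unhappy_left hk hS hN (by omega)⟩

end IsDeepPath

lemma SumEquilibrium.dist_le_two {V : Type} [Finite V] {T : SimpleGraph V} (hT : T.IsTree) {k : ℕ}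
    (hk : 4 ≤ k) (h : SumEquilibrium T k) (x y : V) : T.dist x y ≤ 2 := by
  by_contra hxy
  have : Nonempty (V × V) := ⟨(x, y)⟩
  obtain ⟨⟨x₀, r⟩, hmax⟩ := Finite.exists_max fun p : V × V => T.dist p.1 p.2
  have hD := hmax (x, y)
  simp only at hD
  have hne : ∀ a, T.dist a r ≠ 0 → a ≠ r := by
    rintro a ha rfl
    simp at ha
  obtain ⟨x₁, h01, h1⟩ := exists_adj_dist_add_one hT.connected (hne x₀ (by omega))
  obtain ⟨x₂, h12, h2⟩ := exists_adj_dist_add_one hT.connected (hne x₁ (by omega))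
  obtain ⟨x₃, h23, h3⟩ := exists_adj_dist_add_one hT.connected (hne x₂ (by omega))
  exact IsDeepPath.not_sumEquilibrium (D := T.dist x₀ r) (r := r)
    ⟨hT, h01, h12, h23, rfl, h1, by omega, by omega, fun z => hmax (z, r)⟩ hk h

lemma le_scSum_and_eq_of_dist_le_two {n : ℕ} {T : SimpleGraph (Fin n)} (hT : T.IsTree) :
    2 * n * n + 2 ≤ scSum T + 2 * n + 2 * n ∧
      ((∀ x y, T.dist x y ≤ 2) → scSum T + 2 * n + 2 * n = 2 * n * n + 2) := by
  classical
  have hdeg : ∑ u, ∑ v, (if T.Adj u v then 1 else 0) + 2 = 2 * n := by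
    have h1 := T.sum_degrees_eq_twice_card_edges
    have h2 := hT.card_edgeFinset
    rw [Fintype.card_fin] at h2
    have h3 : ∀ u, ∑ v, (if T.Adj u v then 1 else 0) = T.degree u := by
      intro u
      rw [Finset.sum_boole, ← T.card_neighborFinset_eq_degree, T.neighborFinset_eq_filter]
      rfl
    simp only [h3]
    omega
  have hsum : ∑ u, ∑ v, (T.dist u v + (if T.Adj u v then 1 else 0) + (if u = v then 2 else 0)) + 2
      = scSum T + 2 * n + 2 * n := by
    simp only [Finset.sum_add_distrib, Finset.sum_ite_eq, Finset.mem_univ, if_true,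
      Finset.sum_const, Finset.card_univ, Fintype.card_fin, smul_eq_mul, scSum]
    omega
  have hconst : ∑ u : Fin n, ∑ v : Fin n, 2 = 2 * n * n := by
    simp
    ring
  have hpt : ∀ u v, 2 ≤ T.dist u v + (if T.Adj u v then 1 else 0) + (if u = v then 2 else 0) := by
    intro u v
    by_cases huv : u = v
    · simp [huv]
    · by_cases hadj : T.Adj u v
      · simp [hadj, huv, dist_eq_one_iff_adj.mpr hadj]
      · have := hT.connected.one_lt_dist_of_ne_of_not_adj huv hadj
        simpa [huv, hadj] using Nat.succ_le_of_lt this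
  rw [← hsum, ← hconst]
  refine ⟨Nat.add_le_add_right (Finset.sum_le_sum fun u _ => Finset.sum_le_sum fun v _ =>
    hpt u v) 2, fun hdist => ?_⟩
  congr 1
  refine Finset.sum_congr rfl fun u _ => Finset.sum_congr rfl fun v _ => le_antisymm ?_ (hpt u v)
  by_cases huv : u = v
  · simp [huv]
  · by_cases hadj : T.Adj u v
    · simp [hadj, huv, dist_eq_one_iff_adj.mpr hadj]
    · simpa [huv, hadj] using hdist u v

lemma edist_starGraph_le_two {V : Type} (c x y : V) : (starGraph c).edist x y ≤ 2 := by
  have h1 : ∀ z, (starGraph c).edist c z ≤ 1 := fun z =>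
    edist_le_one_iff_adj_or_eq.mpr (by
      rcases eq_or_ne c z with h | h
      · exact Or.inr h
      · exact Or.inl (starGraph_center_adj h))
  refine (SimpleGraph.edist_triangle (v := c)).trans ?_
  rw [SimpleGraph.edist_comm (u := x), ← one_add_one_eq_two]
  exact add_le_add (h1 x) (h1 y)

lemma sumEquilibrium_starGraph {V : Type} [Finite V] (c : V) (k : ℕ) :
    SumEquilibrium (starGraph c) k := by
  classical
  have := Fintype.ofFinite V
  rintro u ⟨v, w, ⟨huv, -, huw, hwu⟩, hlt⟩
  have huc : u ≠ c := by
    rintro rfl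
    exact huw (starGraph_center_adj hwu.symm)
  obtain rfl : v = c := (starGraph_adj.mp huv).2.resolve_left huc
  have hcompat : Compatible (starGraph v) k u (starGraph v) id :=
    ⟨inferInstance, connected_starGraph v, Function.injective_id.injOn, by simp [ball],
      fun _ _ _ _ => Iff.rfl⟩
  refine (hlt V _ id hcompat).not_ge ?_
  simp only [id, cSum, tsum_fintype]
  rw [← Equiv.sum_comp (Equiv.swap v w)]
  refine Finset.sum_le_sum fun x _ => ?_
  rcases eq_or_ne x u with rfl | hxu
  · rw [Equiv.swap_apply_of_ne_of_ne huc hwu.symm]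
    simp
  rcases eq_or_ne x w with rfl | hxw
  · rw [Equiv.swap_apply_right, edist_eq_one_iff_adj.mpr huv]
    exact Order.one_le_iff_pos.mpr (edist_pos_of_ne hxu.symm)
  · refine (edist_starGraph_le_two _ _ _).trans ?_
    by_contra hlt2
    have h1 : (swapGraph (starGraph v) u v w).edist u x ≤ 1 :=
      Order.le_of_lt_add_one (by simpa [one_add_one_eq_two] using hlt2)
    rcases edist_le_one_iff_adj_or_eq.mp h1 with h2 | h2
    · rcases (swapGraph_adj_s9.mp h2).1 with ⟨h3, h4⟩ | h3
      · exact h4 (by rw [(starGraph_adj.mp h3).2.resolve_left huc])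
      · exact hxw (Sym2.congr_right.mp h3)
    · exact hxu h2.symm

theorem stmt9 (k : ℕ) (hk : 4 ≤ k) (n : ℕ) (hn : 2 ≤ n) :
    (∀ T : SimpleGraph (Fin n), T.IsTree → SumEquilibrium T k →
      ∀ x y : Fin n, T.edist x y ≤ 2) ∧
    PoA n (fun T => SumEquilibrium T k) scSum = 1 := by
  have hdiam : ∀ T : SimpleGraph (Fin n), T.IsTree → SumEquilibrium T k →
      ∀ x y : Fin n, T.dist x y ≤ 2 := fun T hT hE x y => hE.dist_le_two hT hk x y
  refine ⟨fun T hT hE x y => ?_, ?_⟩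
  · rw [← (hT.connected x y).coe_dist_eq_edist]
    exact_mod_cast hdiam T hT hE x y
  have hstar := isTree_starGraph (⟨0, by omega⟩ : Fin n)
  have hstarE := sumEquilibrium_starGraph (⟨0, by omega⟩ : Fin n) k
  generalize starGraph (⟨0, by omega⟩ : Fin n) = Z at hstar hstarE
  have hZ := (le_scSum_and_eq_of_dist_le_two hstar).2 (hdiam Z hstar hstarE)
  have hmax : IsGreatest {m : ℕ | ∃ T : SimpleGraph (Fin n), T.IsTree ∧ SumEquilibrium T k ∧
      scSum T = m} (scSum Z) := by
    refine ⟨⟨Z, hstar, hstarE, rfl⟩, ?_⟩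
    rintro m ⟨T, hT, hE, rfl⟩
    have := (le_scSum_and_eq_of_dist_le_two hT).2 (hdiam T hT hE)
    omega
  have hmin : IsLeast {m : ℕ | ∃ T : SimpleGraph (Fin n), T.IsTree ∧ scSum T = m} (scSum Z) := by
    refine ⟨⟨Z, hstar, rfl⟩, ?_⟩
    rintro m ⟨T, hT, rfl⟩
    have := (le_scSum_and_eq_of_dist_le_two hT).1
    omega
  rw [PoA, hmax.csSup_eq, hmin.csInf_eq]
  refine div_self (Nat.cast_ne_zero.mpr fun h0 => ?_)
  nlinarith

end SwapGame
end
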